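/- arXiv:1601.02724 — 4 statements merged into one kernel-verified Lean document; each statement's English description precedes it below -/
import Mathlib

section
/- There exist t₀ > 0 and a solution X = (x, y, z) : ℝ → ℝ³ of the 1-1-1 ABC flow system such that X(t + t₀) = X(t) + (2π, 0, 0) for every t ∈ ℝ. -/
open Real Set Filter

/-- A solution of the 1-1-1 ABC flow system. -/
def IsABCSol (x y z : ℝ → ℝ) : Prop :=
  ∀ t : ℝ,
    HasDerivAt x (Real.sin (z t) + Real.cos (y t)) t ∧
    HasDerivAt y (Real.sin (x t) + Real.cos (z t)) t ∧
    HasDerivAt z (Real.sin (y t) + Real.cos (x t)) t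

/-- Comparison of two functions on `[0, T]` through their derivatives. -/
lemma le_of_hasDerivAt_le {f f' g g' : ℝ → ℝ} {T : ℝ} (hf : ∀ t, HasDerivAt f (f' t) t)
    (hg : ∀ t, HasDerivAt g (g' t) t) (h0 : f 0 ≤ g 0) (h : ∀ t ∈ Ico 0 T, f' t ≤ g' t) :
    ∀ t ∈ Icc 0 T, f t ≤ g t := fun _ ht =>
  image_le_of_deriv_right_le_deriv_boundary
    (fun t _ => (hf t).continuousAt.continuousWithinAt) (fun t _ => (hf t).hasDerivWithinAt) h0
    (fun t _ => (hg t).continuousAt.continuousWithinAt) (fun t _ => (hg t).hasDerivWithinAt) h ht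

/-- Continuous induction for a strict lower bound. -/
lemma forall_lt_of_forall_Ico_lt {f : ℝ → ℝ} (hf : Continuous f) {c T : ℝ}
    (h : ∀ t ∈ Icc 0 T, (∀ r ∈ Ico 0 t, c < f r) → c < f t) : ∀ t ∈ Icc 0 T, c < f t := by
  by_contra! hne
  obtain ⟨t₁, ht₁, hft₁⟩ := hne
  have hc : IsCompact (Icc 0 T ∩ {t | f t ≤ c}) :=
    isCompact_Icc.inter_right (isClosed_le hf continuous_const)
  obtain ⟨t, ⟨ht, hft⟩, hmin⟩ := hc.exists_isLeast ⟨t₁, ht₁, hft₁⟩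
  refine absurd (h t ht fun r hr => ?_) (not_lt.2 hft)
  by_contra! hr'
  exact absurd (hmin ⟨⟨hr.1, hr.2.le.trans ht.2⟩, hr'⟩) (not_le.2 hr.2)

/-- The ABC system in the coordinate `w = z - π / 2`. -/
def IsShiftedSol (x y w : ℝ → ℝ) : Prop :=
  ∀ t : ℝ,
    HasDerivAt x (cos (w t) + cos (y t)) t ∧
    HasDerivAt y (sin (x t) - sin (w t)) t ∧
    HasDerivAt w (sin (y t) + cos (x t)) t

lemma IsABCSol.isShiftedSol {x y z : ℝ → ℝ} (h : IsABCSol x y z) :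
    IsShiftedSol x y (fun t => z t - π / 2) := by
  intro t
  obtain ⟨hx, hy, hz⟩ := h t
  refine ⟨?_, ?_, hz.sub_const _⟩
  · simpa [cos_sub_pi_div_two] using hx
  · simpa [sin_sub_pi_div_two] using hy

/-- A lower bound of the speed `x'` for the solution issued from `(0, s, 0)`. -/
noncomputable def speedBound (s t : ℝ) : ℝ :=
  2 - (s ^ 2 + 0.02) / 2 - (1 + 1.25 * s) * (49 / 72) * t ^ 4
    - ((1 + 0.84 * s) * t + 0.39 * t ^ 3) ^ 2 / 2

/-- The primitive of `speedBound s`, a lower bound of `x`. -/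
noncomputable def positionBound (s t : ℝ) : ℝ :=
  (2 - (s ^ 2 + 0.02) / 2) * t - (1 + 1.25 * s) * (49 / 360) * t ^ 5
    - ((1 + 0.84 * s) ^ 2 * t ^ 3 / 3 + 0.78 * (1 + 0.84 * s) * t ^ 5 / 5
      + 0.1521 * t ^ 7 / 7) / 2

lemma hasDerivAt_positionBound (s t : ℝ) :
    HasDerivAt (positionBound s) (speedBound s t) t := by
  have h1 := hasDerivAt_id t
  have h3 := hasDerivAt_pow 3 t
  have h5 := hasDerivAt_pow 5 t
  have h7 := hasDerivAt_pow 7 t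
  have h := ((h1.const_mul (2 - (s ^ 2 + 0.02) / 2)).sub
    (h5.const_mul ((1 + 1.25 * s) * (49 / 360)))).sub
    ((((h3.const_mul ((1 + 0.84 * s) ^ 2 / 3)).add
      (h5.const_mul (0.78 * (1 + 0.84 * s) / 5))).add (h7.const_mul (0.1521 / 7))).div_const 2)
  refine (h.congr_deriv ?_).congr_of_eventuallyEq (.of_forall fun r => ?_)
  · simp only [speedBound]; push_cast; ring
  · simp only [positionBound, Pi.sub_apply, Pi.add_apply, id]; ring

lemma speedBound_pos {s t : ℝ} (hs : s ∈ Icc (-0.8) 0) (ht : t ∈ Icc 0 1) :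
    0.3 ≤ speedBound s t := by
  obtain ⟨hs1, hs2⟩ := hs
  obtain ⟨ht1, ht2⟩ := ht
  norm_num at hs1
  have h2 : t ^ 3 ≤ 1 := pow_le_one₀ ht1 ht2
  have h4 : t ^ 4 ≤ 1 := pow_le_one₀ ht1 ht2
  have h3 : 0 ≤ t ^ 3 := by positivity
  have hA : ((1 + 0.84 * s) * t + 0.39 * t ^ 3) ^ 2 ≤ ((1 + 0.84 * s) + 0.39) ^ 2 := by
    apply pow_le_pow_left₀ <;> nlinarith
  have hB : (1 + 1.25 * s) * (49 / 72) * t ^ 4 ≤ (1 + 1.25 * s) * (49 / 72) := by nlinarith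
  unfold speedBound
  nlinarith

lemma speedBound_ge_of_eq {t : ℝ} (ht : t ∈ Icc 0 1) : 1.41 ≤ speedBound (-0.8) t := by
  obtain ⟨ht1, ht2⟩ := ht
  have h2 : t ^ 3 ≤ 1 := pow_le_one₀ ht1 ht2
  have h3 : 0 ≤ t ^ 3 := by positivity
  have hA : ((1 + 0.84 * (-0.8)) * t + 0.39 * t ^ 3) ^ 2 ≤ (0.718 : ℝ) ^ 2 := by
    apply pow_le_pow_left₀ <;> norm_num <;> linarith
  unfold speedBound
  norm_num at hA ⊢
  linarith

lemma positionBound_one {s : ℝ} (hs : s ∈ Icc (-0.8) 0) : π / 2 < positionBound s 1 := by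
  obtain ⟨hs1, hs2⟩ := hs
  norm_num at hs1
  have := pi_lt_d2
  norm_num at this
  unfold positionBound
  nlinarith

lemma le_positionBound {s t : ℝ} (hs : s ∈ Icc (-0.8) 0) (ht : t ∈ Icc 0 1) :
    (1 + 0.84 * s) * t + 0.39 * t ^ 3 ≤ positionBound s t := by
  obtain ⟨hs1, hs2⟩ := hs
  obtain ⟨ht1, ht2⟩ := ht
  norm_num at hs1
  have h3 : t ^ 3 ≤ t := pow_le_of_le_one ht1 ht2 (by norm_num)
  have h5 : t ^ 5 ≤ t := pow_le_of_le_one ht1 ht2 (by norm_num)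
  have h7 : t ^ 7 ≤ t := pow_le_of_le_one ht1 ht2 (by norm_num)
  have e1 : (1 + 1.25 * s) * t ^ 5 ≤ (1 + 1.25 * s) * t := by gcongr; linarith
  have e2 : (1 + 0.84 * s) ^ 2 * t ^ 3 ≤ (1 + 0.84 * s) ^ 2 * t := by gcongr
  have e3 : (1 + 0.84 * s) * t ^ 5 ≤ (1 + 0.84 * s) * t := by gcongr; linarith
  have e4 : 0 ≤ t * (-s * (s + 0.8)) := mul_nonneg ht1 (mul_nonneg (by linarith) (by linarith))
  have e5 : 0 ≤ t * (-s) := mul_nonneg ht1 (by linarith)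
  unfold positionBound
  nlinarith

/-- A priori bounds for the solution issued from `(0, s, 0)`, as long as `x ≤ π / 2` and `y` does
not drop noticeably below its initial value. -/
lemma IsShiftedSol.bounds_of_lt {x y w : ℝ → ℝ} (h : IsShiftedSol x y w) {s T : ℝ}
    (hs : s ∈ Icc (-0.8) 0) (hT : T ≤ 1) (hx0 : x 0 = 0) (hy0 : y 0 = s) (hw0 : w 0 = 0)
    (hx : ∀ t ∈ Ico 0 T, x t ≤ π / 2) (hy : ∀ t ∈ Ico 0 T, s - 0.01 < y t) :
    (∀ t ∈ Ico 0 T, sin (w t) ≤ sin (x t) ∧ speedBound s t ≤ cos (w t) + cos (y t) ∧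
      -1 ≤ w t ∧ w t ≤ x t ∧ |x t| ≤ 2 * t ∧ y t ≤ π / 2) ∧
    ∀ t ∈ Icc 0 T, positionBound s t ≤ x t := by
  obtain ⟨hs1, hs2⟩ := id hs
  norm_num at hs1
  have hpi := pi_gt_three
  have hxabs : ∀ t ∈ Icc 0 T, |x t| ≤ 2 * t := by
    intro t ht
    refine abs_le.2 ⟨?_, ?_⟩
    · refine le_of_hasDerivAt_le (f := fun t => -(2 * t)) (f' := fun _ => -2)
        (fun t => by simpa using ((hasDerivAt_id t).const_mul 2).fun_neg)
        (fun t => (h t).1) (by simp [hx0]) (fun t _ => ?_) t ht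
      linarith [neg_one_le_cos (w t), neg_one_le_cos (y t)]
    · refine le_of_hasDerivAt_le (g := fun t => 2 * t) (g' := fun _ => 2) (fun t => (h t).1)
        (fun t => by simpa using (hasDerivAt_id t).const_mul 2) (by simp [hx0]) (fun t _ => ?_) t ht
      linarith [cos_le_one (w t), cos_le_one (y t)]
  have hwub : ∀ t ∈ Icc 0 T, w t ≤ 2 * t := by
    refine le_of_hasDerivAt_le (g' := fun _ => 2) (fun t => (h t).2.2)
      (fun t => by simpa using (hasDerivAt_id t).const_mul 2) (by simp [hw0]) (fun t _ => ?_)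
    linarith [sin_le_one (y t), cos_le_one (x t)]
  have hwlb : ∀ t ∈ Icc 0 T, -(2 / 3) * t ^ 3 ≤ w t := by
    refine le_of_hasDerivAt_le (f' := fun t => -(2 * t ^ 2))
      (fun t => ((hasDerivAt_pow 3 t).const_mul (-(2 / 3))).congr_deriv (by push_cast; ring))
      (fun t => (h t).2.2) (by simp [hw0]) (fun t ht => ?_)
    have h1 := one_sub_sq_div_two_le_cos (x := x t)
    have h2 : x t ^ 2 ≤ (2 * t) ^ 2 := sq_le_sq' (abs_le.1 (hxabs t ⟨ht.1, ht.2.le⟩)).1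
      (abs_le.1 (hxabs t ⟨ht.1, ht.2.le⟩)).2
    nlinarith [neg_one_le_sin (y t)]
  have hsinw : ∀ t ∈ Icc 0 T, -(2 / 3) * t ^ 3 ≤ sin (w t) := by
    intro t ht
    rcases le_total 0 (w t) with h0 | h0
    · have := sin_nonneg_of_nonneg_of_le_pi h0 (by linarith [hwub t ht, ht.2])
      have h3 : 0 ≤ t ^ 3 := pow_nonneg ht.1 3
      linarith
    · exact (hwlb t ht).trans (le_sin h0)
  have hyub' : ∀ t ∈ Icc 0 T, y t ≤ s + t ^ 2 + t ^ 4 / 6 := by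
    refine le_of_hasDerivAt_le (g' := fun t => 2 * t + 2 / 3 * t ^ 3) (fun t => (h t).2.1)
      (fun t => ((((hasDerivAt_pow 2 t).const_add s).add
        ((hasDerivAt_pow 4 t).div_const 6))).congr_deriv (by push_cast; ring))
      (by simp [hy0]) (fun t ht => ?_)
    have ht' : t ∈ Icc 0 T := ⟨ht.1, ht.2.le⟩
    have h1 : sin (x t) ≤ 2 * t := (le_abs_self _).trans (abs_sin_le_abs.trans (hxabs t ht'))
    linarith [hsinw t ht']
  have hyub : ∀ t ∈ Icc 0 T, y t ≤ s + 7 / 6 * t ^ 2 := by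
    intro t ht
    have h4 : t ^ 4 ≤ t ^ 2 := pow_le_pow_of_le_one ht.1 (ht.2.trans hT) (by norm_num)
    linarith [hyub' t ht]
  have hsins : sin s ≤ 0.84 * s := by
    rcases eq_or_lt_of_le hs2 with rfl | hneg
    · simp
    · have := sin_gt_sub_cube (x := -s) (by linarith)
      rw [sin_neg] at this
      nlinarith [mul_nonneg (neg_nonneg.2 hs2) (mul_nonneg (neg_nonneg.2 hs2)
        (by linarith : 0 ≤ s + 0.8))]
  have hsiny : ∀ t ∈ Ico 0 T, sin (y t) ≤ 0.84 * s + 7 / 6 * t ^ 2 := by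
    intro t ht
    rcases le_total (y t) s with h0 | h0
    · have := sin_le_sin_of_le_of_le_pi_div_two (x := y t) (y := s)
        (by linarith [hy t ht]) (by linarith) h0
      nlinarith [sq_nonneg t]
    · have h1 : sin (y t) - sin s ≤ y t - s := by
        have := abs_sin_sub_sin_le (y t) s
        rw [abs_of_nonneg (sub_nonneg.2 h0)] at this
        exact (le_abs_self _).trans this
      linarith [hyub t ⟨ht.1, ht.2.le⟩]
  have hwub' : ∀ t ∈ Icc 0 T, w t ≤ (1 + 0.84 * s) * t + 7 / 18 * t ^ 3 := by
    refine le_of_hasDerivAt_le (g' := fun t => (1 + 0.84 * s) + 7 / 6 * t ^ 2)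
      (fun t => (h t).2.2)
      (fun t => ((((hasDerivAt_id t).const_mul (1 + 0.84 * s)).add
        ((hasDerivAt_pow 3 t).const_mul (7 / 18)))).congr_deriv (by push_cast; ring))
      (by simp [hw0]) (fun t ht => ?_)
    linarith [hsiny t ht, cos_le_one (x t)]
  have hwsq : ∀ t ∈ Icc 0 T, w t ≤ (1 + 0.84 * s) * t + 0.39 * t ^ 3 ∧
      w t ^ 2 ≤ ((1 + 0.84 * s) * t + 0.39 * t ^ 3) ^ 2 := by
    intro t ht
    have h3 : 0 ≤ t ^ 3 := pow_nonneg ht.1 3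
    have h3' : t ^ 3 ≤ t := pow_le_of_le_one ht.1 (ht.2.trans hT) (by norm_num)
    have h1 : w t ≤ (1 + 0.84 * s) * t + 0.39 * t ^ 3 := by linarith [hwub' t ht]
    refine ⟨h1, sq_le_sq' ?_ h1⟩
    nlinarith [hwlb t ht, ht.1]
  have hysq : ∀ t ∈ Ico 0 T, y t ^ 2 ≤ s ^ 2 + 0.02 + (1 + 1.25 * s) * (49 / 36) * t ^ 4 := by
    intro t ht
    have hu1 : 7 / 6 * t ^ 2 ≤ 1.6 := by nlinarith [ht.1, ht.2, hT]
    have hub := hyub t ⟨ht.1, ht.2.le⟩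
    have hlb := hy t ht
    have hu0 : 0 ≤ 7 / 6 * t ^ 2 := by positivity
    have e : (49 / 36) * t ^ 4 = (7 / 6 * t ^ 2) ^ 2 := by ring
    rw [mul_assoc, e]
    generalize 7 / 6 * t ^ 2 = u at *
    have hP : 0 ≤ (1 + 1.25 * s) * u ^ 2 := mul_nonneg (by linarith) (sq_nonneg u)
    rcases le_total (y t) 0 with h0 | h0
    · nlinarith
    · have h1 : y t ^ 2 ≤ (s + u) ^ 2 := pow_le_pow_left₀ h0 hub 2
      nlinarith [mul_nonneg (neg_nonneg.2 hs2) (mul_nonneg hu0 (sub_nonneg.2 hu1))]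
  have hspeed : ∀ t ∈ Ico 0 T, speedBound s t ≤ cos (w t) + cos (y t) := by
    intro t ht
    have h1 := one_sub_sq_div_two_le_cos (x := w t)
    have h2 := one_sub_sq_div_two_le_cos (x := y t)
    have h3 := (hwsq t ⟨ht.1, ht.2.le⟩).2
    have h4 := hysq t ht
    unfold speedBound
    linarith
  have hpos : ∀ t ∈ Icc 0 T, positionBound s t ≤ x t :=
    le_of_hasDerivAt_le (hasDerivAt_positionBound s) (fun t => (h t).1)
      (by simp [positionBound, hx0]) hspeed
  refine ⟨fun t ht => ?_, hpos⟩
  have ht' : t ∈ Icc 0 T := ⟨ht.1, ht.2.le⟩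
  have hwx : w t ≤ x t := ((hwsq t ht').1.trans
    (le_positionBound hs ⟨ht.1, ht'.2.trans hT⟩)).trans (hpos t ht')
  have hw1 : -1 ≤ w t := by
    have h3 : t ^ 3 ≤ 1 := pow_le_one₀ ht.1 (ht'.2.trans hT)
    linarith [hwlb t ht']
  exact ⟨sin_le_sin_of_le_of_le_pi_div_two (by linarith) (hx t ht) hwx, hspeed t ht, hw1, hwx,
    hxabs t ht', by nlinarith [hyub t ht', ht.1, ht.2, hT]⟩

/-- Along the solution issued from `(0, s, 0)`, `y` stays above its initial value as long as
`x ≤ π / 2`. -/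
lemma IsShiftedSol.le_snd {x y w : ℝ → ℝ} (h : IsShiftedSol x y w) {s T : ℝ}
    (hs : s ∈ Icc (-0.8) 0) (hT : T ≤ 1) (hx0 : x 0 = 0) (hy0 : y 0 = s) (hw0 : w 0 = 0)
    (hx : ∀ t ∈ Ico 0 T, x t ≤ π / 2) : ∀ t ∈ Icc 0 T, s ≤ y t := by
  have key : ∀ t ∈ Icc 0 T, (∀ r ∈ Ico 0 t, s - 0.01 < y r) → s ≤ y t := by
    intro t ht hr
    have hb := (h.bounds_of_lt hs (ht.2.trans hT) hx0 hy0 hw0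
      (fun r hr => hx r ⟨hr.1, hr.2.trans_le ht.2⟩) hr).1
    exact le_of_hasDerivAt_le (f := fun _ => s) (f' := fun _ => 0) (fun t => hasDerivAt_const t s)
      (fun t => (h t).2.1) hy0.ge (fun r hr => sub_nonneg.2 (hb r hr).1) t ⟨ht.1, le_rfl⟩
  have hlt := forall_lt_of_forall_Ico_lt
    (continuous_iff_continuousAt.2 fun t => (h t).2.1.continuousAt) (c := s - 0.01) (T := T)
    fun t ht hr => by linarith [key t ht hr]
  exact fun t ht => key t ht fun r hr => hlt r ⟨hr.1, hr.2.le.trans ht.2⟩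

lemma IsShiftedSol.bounds {x y w : ℝ → ℝ} (h : IsShiftedSol x y w) {s T : ℝ}
    (hs : s ∈ Icc (-0.8) 0) (hT : T ≤ 1) (hx0 : x 0 = 0) (hy0 : y 0 = s) (hw0 : w 0 = 0)
    (hx : ∀ t ∈ Ico 0 T, x t ≤ π / 2) :
    (∀ t ∈ Ico 0 T, sin (w t) ≤ sin (x t) ∧ speedBound s t ≤ cos (w t) + cos (y t) ∧
      -1 ≤ w t ∧ w t ≤ x t ∧ |x t| ≤ 2 * t ∧ y t ≤ π / 2) ∧
    ∀ t ∈ Icc 0 T, positionBound s t ≤ x t :=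
  h.bounds_of_lt hs hT hx0 hy0 hw0 hx fun t ht => by
    linarith [h.le_snd hs hT hx0 hy0 hw0 hx t ⟨ht.1, ht.2.le⟩]

/-- `x` is strictly increasing as long as it does not exceed `π / 2`. -/
lemma IsShiftedSol.fst_lt {x y w : ℝ → ℝ} (h : IsShiftedSol x y w) {s T : ℝ}
    (hs : s ∈ Icc (-0.8) 0) (hT : T ≤ 1) (hx0 : x 0 = 0) (hy0 : y 0 = s) (hw0 : w 0 = 0)
    (hx : ∀ t ∈ Ico 0 T, x t ≤ π / 2) {t : ℝ} (ht : t ∈ Ico 0 T) : x t < x T := by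
  have hb := (h.bounds hs hT hx0 hy0 hw0 hx).1
  refine strictMonoOn_of_deriv_pos (convex_Icc 0 T)
    (fun t _ => (h t).1.continuousAt.continuousWithinAt) (fun r hr => ?_)
    ⟨ht.1, ht.2.le⟩ ⟨ht.1.trans ht.2.le, le_rfl⟩ ht.2
  rw [interior_Icc] at hr
  rw [(h r).1.deriv]
  linarith [(hb r ⟨hr.1.le, hr.2⟩).2.1, speedBound_pos hs ⟨hr.1.le, hr.2.le.trans hT⟩]

/-- `x` reaches `π / 2` before time `1`. -/
lemma IsShiftedSol.exists_fst_eq {x y w : ℝ → ℝ} (h : IsShiftedSol x y w) {s : ℝ}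
    (hs : s ∈ Icc (-0.8) 0) (hx0 : x 0 = 0) (hy0 : y 0 = s) (hw0 : w 0 = 0) :
    ∃ T ∈ Icc (0 : ℝ) 1, x T = π / 2 ∧ ∀ r ∈ Icc 0 T, x r ≤ π / 2 := by
  have hcont : Continuous x := continuous_iff_continuousAt.2 fun t => (h t).1.continuousAt
  have hc : IsCompact (Icc 0 1 ∩ {t | π / 2 ≤ x t}) :=
    isCompact_Icc.inter_right (isClosed_le continuous_const hcont)
  have hne : (Icc 0 1 ∩ {t | π / 2 ≤ x t}).Nonempty := by
    by_contra! hemp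
    have hlt : ∀ t ∈ Icc 0 1, x t < π / 2 := fun t ht => by
      by_contra! h'
      exact (hemp ▸ (⟨ht, h'⟩ : t ∈ Icc 0 1 ∩ {t | π / 2 ≤ x t}) : t ∈ (∅ : Set ℝ))
    have h1 := (h.bounds hs le_rfl hx0 hy0 hw0 fun t ht => (hlt t ⟨ht.1, ht.2.le⟩).le).2 1
      (by simp)
    linarith [positionBound_one hs, hlt 1 (by simp)]
  obtain ⟨T, ⟨hT, hxT⟩, hmin⟩ := hc.exists_isLeast hne
  have hbelow : ∀ r ∈ Ico 0 T, x r < π / 2 := fun r hr => by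
    by_contra! h'
    exact absurd (hmin ⟨⟨hr.1, hr.2.le.trans hT.2⟩, h'⟩) (not_le.2 hr.2)
  obtain ⟨r, hr, hxr⟩ := intermediate_value_Icc hT.1 hcont.continuousOn
    (⟨by rw [hx0]; positivity, hxT⟩ : π / 2 ∈ Icc (x 0) (x T))
  have hrT : r = T := by
    by_contra hne
    exact absurd hxr (hbelow r ⟨hr.1, lt_of_le_of_ne hr.2 hne⟩).ne
  rw [hrT] at hxr
  refine ⟨T, hT, hxr, fun r hr => ?_⟩
  rcases eq_or_lt_of_le hr.2 with rfl | hlt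
  · exact hxr.le
  · exact (hbelow r ⟨hr.1, hlt⟩).le

lemma sub_le_sin {v : ℝ} (hv : v ≤ 0.1) : v - 0.01 ≤ sin v := by
  rcases le_or_gt v 0 with h0 | h0
  · linarith [le_sin h0]
  · have h1 := sin_gt_sub_cube h0
    have h3 : v ^ 3 ≤ 0.1 ^ 3 := pow_le_pow_left₀ h0.le hv 3
    norm_num at h3
    linarith

/-- For `s = -0.8`, `y` is still nonpositive when `x` reaches `π / 2`. -/
lemma IsShiftedSol.snd_nonpos {x y w : ℝ → ℝ} (h : IsShiftedSol x y w) {T : ℝ}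
    (hT : T ∈ Icc 0 1) (hx0 : x 0 = 0) (hy0 : y 0 = -0.8) (hw0 : w 0 = 0)
    (hx : ∀ t ∈ Icc 0 T, x t ≤ π / 2) : y T ≤ 0 := by
  have hs : (-0.8 : ℝ) ∈ Icc (-0.8) 0 := by norm_num
  have hx' : ∀ t ∈ Ico 0 T, x t ≤ π / 2 := fun t ht => hx t ⟨ht.1, ht.2.le⟩
  have hpi := pi_gt_three
  have hylb := h.le_snd hs hT.2 hx0 hy0 hw0 hx'
  obtain ⟨hb, hpos⟩ := h.bounds hs hT.2 hx0 hy0 hw0 hx'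
  have hxnn : ∀ t ∈ Icc 0 T, 0 ≤ x t := by
    intro t ht
    refine le_trans ?_ ((le_positionBound hs ⟨ht.1, ht.2.trans hT.2⟩).trans (hpos t ht))
    have := ht.1
    norm_num
    positivity
  have hsin : -0.74 ≤ sin (-0.8) := by
    have := sin_bound (x := -0.8) (by rw [abs_le]; norm_num)
    have h2 := (abs_le.1 this).1
    rw [abs_of_nonpos (by norm_num)] at h2
    norm_num at h2 ⊢
    linarith
  have hwlb : ∀ t ∈ Icc 0 T, 0.26 * t - 2 / 3 * t ^ 3 ≤ w t := by
    refine le_of_hasDerivAt_le (f' := fun t => 0.26 - 2 * t ^ 2)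
      (fun t => (((hasDerivAt_id t).const_mul 0.26).sub
        ((hasDerivAt_pow 3 t).const_mul (2 / 3))).congr_deriv (by push_cast; ring))
      (fun t => (h t).2.2) (by simp [hw0]) (fun t ht => ?_)
    have h1 := one_sub_sq_div_two_le_cos (x := x t)
    obtain ⟨-, -, -, -, hxa, hyπ⟩ := hb t ht
    have h2 : x t ^ 2 ≤ (2 * t) ^ 2 := sq_le_sq' (abs_le.1 hxa).1 (abs_le.1 hxa).2
    have h3 : sin (-0.8) ≤ sin (y t) :=
      sin_le_sin_of_le_of_le_pi_div_two (by norm_num; linarith) hyπ (hylb t ⟨ht.1, ht.2.le⟩)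
    nlinarith
  have hmain := le_of_hasDerivAt_le (T := T)
    (f := fun t => y t + 0.71 * cos (x t))
    (f' := fun t => sin (x t) - sin (w t) + 0.71 * (-sin (x t) * (cos (w t) + cos (y t))))
    (g := fun t => -0.8 + 0.71 + 0.01 * t - 0.13 * t ^ 2 + t ^ 4 / 6)
    (g' := fun t => 0.01 - 0.26 * t + 2 / 3 * t ^ 3)
    (fun t => (h t).2.1.add (((h t).1.cos).const_mul 0.71))
    (fun t => (((((hasDerivAt_id t).const_mul 0.01).const_add (-0.8 + 0.71)).sub
        ((hasDerivAt_pow 2 t).const_mul 0.13)).add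
          ((hasDerivAt_pow 4 t).div_const 6)).congr_deriv (by push_cast; ring))
    (by simp [hx0, hy0]) (fun t ht => ?_) T ⟨hT.1, le_rfl⟩
  · have hc : 0 ≤ cos (x T) := cos_nonneg_of_mem_Icc
      ⟨by linarith [hxnn T ⟨hT.1, le_rfl⟩], hx T ⟨hT.1, le_rfl⟩⟩
    have h4 : T ^ 4 ≤ T ^ 2 := pow_le_pow_of_le_one hT.1 hT.2 (by norm_num)
    have h2 : T ^ 2 ≤ 1 := pow_le_one₀ hT.1 hT.2
    norm_num at hmain
    linarith [hT.2]
  · have ht' : t ∈ Icc 0 T := ⟨ht.1, ht.2.le⟩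
    obtain ⟨-, hsp, hw1, hwx, -⟩ := hb t ht
    have hsp' := speedBound_ge_of_eq ⟨ht.1, ht'.2.trans hT.2⟩
    have hsx : 0 ≤ sin (x t) := sin_nonneg_of_nonneg_of_le_pi (hxnn t ht')
      (by linarith [hx t ht'])
    have hlow : 0.26 * t - 2 / 3 * t ^ 3 ≤ 0.1 := by
      nlinarith [ht.1, mul_nonneg ht.1 (sq_nonneg (t - 0.36)), sq_nonneg (t - 0.36)]
    have hlow' : -1 ≤ 0.26 * t - 2 / 3 * t ^ 3 := by
      have : t ^ 3 ≤ 1 := pow_le_one₀ ht.1 (ht'.2.trans hT.2)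
      linarith [ht.1]
    have hsw : sin (0.26 * t - 2 / 3 * t ^ 3) ≤ sin (w t) :=
      sin_le_sin_of_le_of_le_pi_div_two (by linarith) (hwx.trans (hx t ht')) (hwlb t ht')
    have := sub_le_sin hlow
    nlinarith [mul_le_mul_of_nonneg_left (hsp'.trans hsp) hsx]

/-- A bounded Lipschitz vector field has global integral curves. -/
lemma exists_forall_hasDerivAt_of_lipschitzWith {E : Type*} [NormedAddCommGroup E]
    [NormedSpace ℝ E] [CompleteSpace E] {v : E → E} {K L : NNReal} (hv : LipschitzWith K v)
    (hL : ∀ p, ‖v p‖ ≤ L) (p : E) :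
    ∃ γ : ℝ → E, γ 0 = p ∧ ∀ t, HasDerivAt γ (v (γ t)) t := by
  have hloc : ∀ n : ℕ, ∃ α : ℝ → E, α 0 = p ∧
      ∀ t ∈ Ioo (-(n + 1) : ℝ) (n + 1), HasDerivAt α (v (α t)) t := by
    intro n
    have hn : (0 : ℝ) ∈ Icc (-(n + 1) : ℝ) (n + 1) := by
      constructor <;> linarith [n.cast_nonneg (α := ℝ)]
    have hP : IsPicardLindelof (fun _ => v) (⟨0, hn⟩ : Icc (-(n + 1) : ℝ) (n + 1)) p
        (L * (n + 1)) 0 L K :=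
      { lipschitzOnWith := fun t _ => hv.lipschitzOnWith
        continuousOn := fun _ _ => continuousOn_const
        norm_le := fun _ _ q _ => hL q
        mul_max_le := by simp }
    obtain ⟨α, h0, hα⟩ := hP.exists_eq_forall_mem_Icc_hasDerivWithinAt₀
    exact ⟨α, h0, fun t ht =>
      (hα t ⟨ht.1.le, ht.2.le⟩).hasDerivAt (Icc_mem_nhds ht.1 ht.2)⟩
  choose α hα0 hα using hloc
  have hagree : ∀ m n : ℕ, m ≤ n → ∀ t ∈ Ioo (-(m + 1) : ℝ) (m + 1), α m t = α n t := by
    intro m n hmn t ht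
    have hmn' : (m : ℝ) ≤ n := by exact_mod_cast hmn
    have hm := m.cast_nonneg (α := ℝ)
    refine ODE_solution_unique_of_mem_Ioo (v := fun _ => v) (s := fun _ => univ) (t₀ := 0)
      (fun _ _ => hv.lipschitzOnWith) ⟨by linarith, by linarith⟩
      (fun t ht => ⟨hα m t ht, trivial⟩)
      (fun t ht => ⟨hα n t ⟨by linarith [ht.1], by linarith [ht.2]⟩, trivial⟩)
      (by rw [hα0, hα0]) ht
  have hfloor : ∀ t : ℝ, t ∈ Ioo (-(⌊|t|⌋₊ + 1) : ℝ) (⌊|t|⌋₊ + 1) := fun t =>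
    abs_lt.1 (Nat.lt_floor_add_one |t|)
  have heq : ∀ (n : ℕ), ∀ t ∈ Ioo (-(n + 1) : ℝ) (n + 1), α ⌊|t|⌋₊ t = α n t := by
    intro n t ht
    rcases le_total ⌊|t|⌋₊ n with h | h
    · exact hagree _ _ h t (hfloor t)
    · exact (hagree _ _ h t ht).symm
  refine ⟨fun t => α ⌊|t|⌋₊ t, hα0 _, fun t => ?_⟩
  refine (hα ⌊|t|⌋₊ t (hfloor t)).congr_of_eventuallyEq ?_
  filter_upwards [Ioo_mem_nhds (hfloor t).1 (hfloor t).2] with r hr using heq _ r hr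

/-- The vector field of the 1-1-1 ABC flow. -/
noncomputable def abcField (p : ℝ × ℝ × ℝ) : ℝ × ℝ × ℝ :=
  (sin p.2.2 + cos p.2.1, sin p.1 + cos p.2.2, sin p.2.1 + cos p.1)

lemma abs_sin_add_cos_sub_le {a b c d r : ℝ} (h1 : |a - c| ≤ r) (h2 : |b - d| ≤ r) :
    |(sin a + cos b) - (sin c + cos d)| ≤ 2 * r := by
  have h3 := (abs_sin_sub_sin_le a c).trans h1
  have h4 := (abs_cos_sub_cos_le b d).trans h2
  calc _ = |(sin a - sin c) + (cos b - cos d)| := by congr 1; ring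
    _ ≤ _ := (abs_add_le _ _).trans (by linarith)

lemma lipschitzWith_abcField : LipschitzWith 2 abcField := by
  refine LipschitzWith.of_dist_le_mul fun p q => ?_
  have h1 : |p.1 - q.1| ≤ dist p q := le_max_left _ _
  have h2 : |p.2.1 - q.2.1| ≤ dist p q := (le_max_left _ _).trans (le_max_right _ _)
  have h3 : |p.2.2 - q.2.2| ≤ dist p q := (le_max_right _ _).trans (le_max_right _ _)
  exact max_le (abs_sin_add_cos_sub_le h3 h2)
    (max_le (abs_sin_add_cos_sub_le h1 h3) (abs_sin_add_cos_sub_le h2 h1))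

lemma norm_abcField_le (p : ℝ × ℝ × ℝ) : ‖abcField p‖ ≤ (2 : NNReal) := by
  have h : ∀ a b : ℝ, |sin a + cos b| ≤ 2 := fun a b =>
    (abs_add_le _ _).trans (by linarith [abs_sin_le_one a, abs_cos_le_one b])
  exact max_le (h _ _) (max_le (h _ _) (h _ _))

lemma isABCSol_iff {γ : ℝ → ℝ × ℝ × ℝ} :
    IsABCSol (fun t => (γ t).1) (fun t => (γ t).2.1) (fun t => (γ t).2.2) ↔
      ∀ t, HasDerivAt γ (abcField (γ t)) t := by
  refine forall_congr' fun t => ⟨fun h => h.1.prodMk (h.2.1.prodMk h.2.2), fun h => ?_⟩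
  have h2 := (ContinuousLinearMap.snd ℝ ℝ (ℝ × ℝ)).hasFDerivAt.comp_hasDerivAt t h
  exact ⟨(ContinuousLinearMap.fst ℝ ℝ (ℝ × ℝ)).hasFDerivAt.comp_hasDerivAt t h,
    (ContinuousLinearMap.fst ℝ ℝ ℝ).hasFDerivAt.comp_hasDerivAt t h2,
    (ContinuousLinearMap.snd ℝ ℝ ℝ).hasFDerivAt.comp_hasDerivAt t h2⟩

/-- Two solutions of the ABC system which agree at one time are equal. -/
lemma IsABCSol.eq_of_eq_at {x y z x' y' z' : ℝ → ℝ} (h : IsABCSol x y z)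
    (h' : IsABCSol x' y' z') {t₀ : ℝ} (hx : x t₀ = x' t₀) (hy : y t₀ = y' t₀)
    (hz : z t₀ = z' t₀) (t : ℝ) : x t = x' t ∧ y t = y' t ∧ z t = z' t := by
  have := ODE_solution_unique_univ (v := fun _ => abcField) (s := fun _ => univ) (t₀ := t₀)
    (f := fun t => (x t, y t, z t)) (g := fun t => (x' t, y' t, z' t))
    (fun _ => lipschitzWith_abcField.lipschitzOnWith)
    (fun t => ⟨(isABCSol_iff (γ := fun t => (x t, y t, z t))).1 h t, trivial⟩)
    (fun t => ⟨(isABCSol_iff (γ := fun t => (x' t, y' t, z' t))).1 h' t, trivial⟩)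
    (by simp [hx, hy, hz])
  simpa using congrFun this t

/-- The time-reversing symmetry fixing the line `x = 0`, `z = π / 2`. -/
lemma IsABCSol.reflect_fst {x y z : ℝ → ℝ} (h : IsABCSol x y z) :
    IsABCSol (fun t => -x (-t)) (fun t => y (-t)) (fun t => π - z (-t)) := by
  intro t
  obtain ⟨hx, hy, hz⟩ := h (-t)
  have hn : HasDerivAt (fun t : ℝ => -t) (-1) t := hasDerivAt_neg t
  refine ⟨((hx.comp t hn).fun_neg).congr_deriv ?_, (hy.comp t hn).congr_deriv ?_,
    ((hz.comp t hn).const_sub π).congr_deriv ?_⟩ <;> simp [sin_pi_sub, cos_pi_sub]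
  ring

/-- The time-reversing symmetry about time `T` fixing the line `x = π / 2`, `y = 0`. -/
lemma IsABCSol.reflect_snd {x y z : ℝ → ℝ} (h : IsABCSol x y z) (T : ℝ) :
    IsABCSol (fun t => π - x (2 * T - t)) (fun t => -y (2 * T - t)) (fun t => z (2 * T - t)) := by
  intro t
  obtain ⟨hx, hy, hz⟩ := h (2 * T - t)
  have hn : HasDerivAt (fun t : ℝ => 2 * T - t) (-1) t := (hasDerivAt_id t).const_sub _
  refine ⟨((hx.comp t hn).const_sub π).congr_deriv ?_, ((hy.comp t hn).fun_neg).congr_deriv ?_,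
    (hz.comp t hn).congr_deriv ?_⟩ <;> simp [sin_pi_sub, cos_pi_sub]
  ring

/-- A solution joining the two symmetry lines is periodic up to a translation by `2 π` in `x`. -/
lemma IsABCSol.add_four_mul {x y z : ℝ → ℝ} (h : IsABCSol x y z) {T : ℝ} (hx0 : x 0 = 0)
    (hz0 : z 0 = π / 2) (hxT : x T = π / 2) (hyT : y T = 0) (t : ℝ) :
    x (t + 4 * T) = x t + 2 * π ∧ y (t + 4 * T) = y t ∧ z (t + 4 * T) = z t := by
  have h1 := h.eq_of_eq_at h.reflect_fst (t₀ := 0) (by simp [hx0]) (by simp)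
    (by simp [hz0]; ring)
  have e : 2 * T - T = T := by ring
  have h2 := h.eq_of_eq_at (h.reflect_snd T) (t₀ := T) (by simp only [e, hxT]; ring)
    (by simp [e, hyT]) (by simp [e])
  have glide : ∀ t, x (t + 2 * T) = x t + π ∧ y (t + 2 * T) = -y t ∧ z (t + 2 * T) = π - z t := by
    intro t
    obtain ⟨a1, a2, a3⟩ := h1 t
    obtain ⟨b1, b2, b3⟩ := h2 (t + 2 * T)
    simp only [sub_add_cancel_right] at b1 b2 b3
    refine ⟨?_, ?_, ?_⟩ <;> ring_nf at * <;> linarith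
  obtain ⟨a1, a2, a3⟩ := glide t
  obtain ⟨b1, b2, b3⟩ := glide (t + 2 * T)
  have e4 : t + 4 * T = t + 2 * T + 2 * T := by ring
  rw [e4]
  exact ⟨by linarith, by linarith, by linarith⟩

/-- Some solution joins the lines `x = 0`, `z = π / 2` and `x = π / 2`, `y = 0`. -/
lemma exists_isABCSol_connecting : ∃ T > (0 : ℝ), ∃ x y z : ℝ → ℝ, IsABCSol x y z ∧
    x 0 = 0 ∧ z 0 = π / 2 ∧ x T = π / 2 ∧ y T = 0 := by
  choose γ hγ0 hγ using fun s : ℝ => exists_forall_hasDerivAt_of_lipschitzWith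
    lipschitzWith_abcField norm_abcField_le (0, s, π / 2)
  have hsol : ∀ s, IsShiftedSol (fun t => (γ s t).1) (fun t => (γ s t).2.1)
    (fun t => (γ s t).2.2 - π / 2) := fun s => (isABCSol_iff.2 (hγ s)).isShiftedSol
  have hx0 : ∀ s, (γ s 0).1 = 0 := fun s => by rw [hγ0]
  have hy0 : ∀ s, (γ s 0).2.1 = s := fun s => by rw [hγ0]
  have hw0 : ∀ s, (γ s 0).2.2 - π / 2 = 0 := fun s => by rw [hγ0]; simp
  have hcγ : ∀ s, Continuous (γ s) := fun s =>
    continuous_iff_continuousAt.2 fun t => (hγ s t).continuousAt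
  set R : Set (ℝ × ℝ) := Icc (-0.8) 0 ×ˢ Icc 0 1 with hR
  have hRc : IsCompact R := isCompact_Icc.prod isCompact_Icc
  have hcont : ContinuousOn (fun p : ℝ × ℝ => γ p.1 p.2) R := by
    refine continuousOn_prod_of_continuousOn_lipschitzOnWith _ (Real.toNNReal (exp 2))
      (fun s _ => (hcγ s).continuousOn) fun t ht =>
        LipschitzOnWith.of_dist_le_mul fun s _ s' _ => ?_
    have hd : dist (γ s 0) (γ s' 0) ≤ dist s s' := by
      rw [hγ0, hγ0]; simp [Prod.dist_eq]
    have := dist_le_of_trajectories_ODE (v := fun _ => abcField)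
      (fun _ => lipschitzWith_abcField) (hcγ s).continuousOn
      (fun t _ => (hγ s t).hasDerivWithinAt) (hcγ s').continuousOn
      (fun t _ => (hγ s' t).hasDerivWithinAt) hd t ht
    refine this.trans ?_
    rw [Real.coe_toNNReal _ (exp_pos 2).le, mul_comm]
    gcongr
    norm_num
    linarith [ht.2]
  -- the pairs `(s, t)` for which `x` reaches `π / 2` for the first time at `t`
  set S : Set (ℝ × ℝ) := {p ∈ R | (γ p.1 p.2).1 = π / 2 ∧
    ∀ c ∈ Icc (0 : ℝ) 1, (γ p.1 (c * p.2)).1 ≤ π / 2} with hS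
  have hscale : ∀ c ∈ Icc (0 : ℝ) 1, ContinuousOn (fun p : ℝ × ℝ => γ p.1 (c * p.2)) R := by
    intro c hc
    refine hcont.comp (f := fun p : ℝ × ℝ => (p.1, c * p.2)) (by fun_prop) fun p hp => ?_
    exact ⟨hp.1, mul_nonneg hc.1 hp.2.1, mul_le_one₀ hc.2 hp.2.1 hp.2.2⟩
  have hSclosed : IsClosed S := by
    have e : S = (R ∩ (fun p : ℝ × ℝ => (γ p.1 p.2).1) ⁻¹' {π / 2}) ∩
        ⋂ c ∈ Icc (0 : ℝ) 1, (R ∩ (fun p : ℝ × ℝ => (γ p.1 (c * p.2)).1) ⁻¹' Iic (π / 2)) := by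
      ext p
      simp only [hS, mem_ofPred_eq, mem_inter_iff, mem_preimage, mem_singleton_iff, mem_iInter,
        mem_Iic]
      constructor
      · rintro ⟨h1, h2, h3⟩
        exact ⟨⟨h1, h2⟩, fun c hc => ⟨h1, h3 c hc⟩⟩
      · rintro ⟨⟨h1, h2⟩, h3⟩
        exact ⟨h1, h2, fun c hc => (h3 c hc).2⟩
    rw [e]
    exact ((continuous_fst.comp_continuousOn hcont).preimage_isClosed_of_isClosed
      hRc.isClosed isClosed_singleton).inter (isClosed_biInter fun c hc =>
        (continuous_fst.comp_continuousOn (hscale c hc)).preimage_isClosed_of_isClosed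
          hRc.isClosed isClosed_Iic)
  have hSR : S ⊆ R := fun p hp => hp.1
  have hSc : IsCompact S := hRc.of_isClosed_subset hSclosed hSR
  have hycont : ContinuousOn (fun p : ℝ × ℝ => (γ p.1 p.2).2.1) S :=
    (continuous_fst.comp continuous_snd).comp_continuousOn (hcont.mono hSR)
  have hle : ∀ p ∈ S, ∀ r ∈ Icc 0 p.2, (γ p.1 r).1 ≤ π / 2 := by
    intro p hp r hr
    rcases eq_or_lt_of_le (hr.1.trans hr.2) with h0 | h0
    · have : r = 0 := le_antisymm (h0 ▸ hr.2) hr.1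
      rw [this, hx0]; positivity
    · have := hp.2.2 (r / p.2) ⟨div_nonneg hr.1 h0.le, (div_le_one h0).2 hr.2⟩
      rwa [div_mul_cancel₀ _ h0.ne'] at this
  have hex : ∀ s ∈ Icc (-0.8 : ℝ) 0, ∃ t, (s, t) ∈ S := by
    intro s hs
    obtain ⟨T, hT, h1, h2⟩ := (hsol s).exists_fst_eq hs (hx0 s) (hy0 s) (hw0 s)
    exact ⟨T, ⟨hs, hT⟩, h1, fun c hc =>
      h2 _ ⟨mul_nonneg hc.1 hT.1, mul_le_of_le_one_left hT.1 hc.2⟩⟩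
  have huniq : ∀ s t t', (s, t) ∈ S → (s, t') ∈ S → t' ≤ t := by
    intro s t t' h h'
    by_contra! hlt
    have := (hsol s).fst_lt h'.1.1 h'.1.2.2 (hx0 s) (hy0 s) (hw0 s)
      (fun r hr => hle _ h' r ⟨hr.1, hr.2.le⟩) ⟨h.1.2.1, hlt⟩
    exact absurd (h.2.1.trans h'.2.1.symm) this.ne
  have hproj : ∀ C : Set ℝ, IsClosed C →
      IsClosed (Prod.fst '' (S ∩ (fun p : ℝ × ℝ => (γ p.1 p.2).2.1) ⁻¹' C)) := fun C hC =>
    ((hSc.of_isClosed_subset (hycont.preimage_isClosed_of_isClosed hSclosed hC)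
      inter_subset_left).image continuous_fst).isClosed
  have hsne : (-0.8 : ℝ) ∈ Icc (-0.8 : ℝ) 0 := by norm_num
  have hs0 : (0 : ℝ) ∈ Icc (-0.8 : ℝ) 0 := by norm_num
  obtain ⟨s, hs, ⟨⟨s₁, t⟩, ⟨hp, hpy⟩, rfl⟩, ⟨⟨s₂, t'⟩, ⟨hp', hpy'⟩, hss⟩⟩ :=
    isPreconnected_closed_iff.1 (isPreconnected_Icc (a := (-0.8 : ℝ)) (b := 0)) _ _
      (hproj _ isClosed_Iic) (hproj _ isClosed_Ici)
      (by
        intro s hs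
        obtain ⟨t, ht⟩ := hex s hs
        rcases le_total (γ s t).2.1 0 with h | h
        · exact .inl ⟨(s, t), ⟨ht, h⟩, rfl⟩
        · exact .inr ⟨(s, t), ⟨ht, h⟩, rfl⟩)
      (by
        obtain ⟨t, ht⟩ := hex _ hsne
        exact ⟨_, hsne, (_, t), ⟨ht, (hsol _).snd_nonpos ht.1.2 (hx0 _) (hy0 _) (hw0 _)
          (hle _ ht)⟩, rfl⟩)
      (by
        obtain ⟨t, ht⟩ := hex _ hs0
        exact ⟨_, hs0, (_, t), ⟨ht, (hsol _).le_snd hs0 ht.1.2.2 (hx0 _) (hy0 _) (hw0 _)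
          (fun r hr => hle _ ht r ⟨hr.1, hr.2.le⟩) t ⟨ht.1.2.1, le_rfl⟩⟩, rfl⟩)
  obtain rfl : s₂ = s₁ := hss
  obtain rfl : t = t' := le_antisymm (huniq _ _ _ hp' hp) (huniq _ _ _ hp hp')
  refine ⟨t, lt_of_le_of_ne hp.1.2.1 fun h0 => ?_, _, _, _, isABCSol_iff.2 (hγ s₂), hx0 s₂,
    by rw [hγ0], hp.2.1, le_antisymm hpy hpy'⟩
  have h1 := hp.2.1
  simp only [← h0, hx0] at h1
  linarith [pi_pos]

theorem stmt0 :
    ∃ t₀ > (0 : ℝ), ∃ x y z : ℝ → ℝ, IsABCSol x y z ∧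
      ∀ t : ℝ, x (t + t₀) = x t + 2 * π ∧ y (t + t₀) = y t ∧ z (t + t₀) = z t := by
  obtain ⟨T, hT, x, y, z, h, hx0, hz0, hxT, hyT⟩ := exists_isABCSol_connecting
  exact ⟨4 * T, by positivity, x, y, z, h, h.add_four_mul hx0 hz0 hxT hyT⟩
end

section
/- If X = (x, y, z) : ℝ → ℝ³ is a solution of the 1-1-1 ABC flow system and c ∈ ℝ, then the curve t ↦ (-π - x(c - t), -y(c - t), z(c - t)) is also a solution of the 1-1-1 ABC flow system. -/
open Real Set Filter

theorem stmt4 (x y z : ℝ → ℝ) (h : IsABCSol x y z) (c : ℝ) :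
    IsABCSol (fun t => -π - x (c - t)) (fun t => -y (c - t)) (fun t => z (c - t)) := by
  intro t
  obtain ⟨hx, hy, hz⟩ := h (c - t)
  have hsin : sin (-π - x (c - t)) = sin (x (c - t)) := by
    rw [← neg_add', sin_neg, add_comm, sin_add_pi, neg_neg]
  have hcos : cos (-π - x (c - t)) = -cos (x (c - t)) := by
    rw [← neg_add', cos_neg, add_comm, cos_add_pi]
  refine ⟨?_, ?_, ?_⟩
  · simpa using (hx.comp_const_sub c t).const_sub (-π)
  · simpa [hsin] using (hy.comp_const_sub c t).fun_neg
  · simpa [hcos, add_comm] using hz.comp_const_sub c t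
end

section
/- There exists a solution X = (x, y, z) : ℝ → ℝ³ of the 1-1-1 ABC flow system and a constant c > 0 such that x(t)/t → c as t → ∞; in particular, the 1-1-1 ABC flow system has an orbit that is unbounded in the x-direction and travels linearly in time. -/
open Real Set Filter

open scoped NNReal

/-! ### Global solutions of autonomous equations with a bounded Lipschitz right-hand side -/

section GlobalSolution

variable {E : Type*} [NormedAddCommGroup E] [NormedSpace ℝ E]

theorem exists_hasDerivAt_of_lipschitzWith_of_bounded [CompleteSpace E] {f : E → E} {K L : ℝ≥0}
    (hf : LipschitzWith K f) (hL : ∀ p, ‖f p‖ ≤ L) (p : E) :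
    ∃ α : ℝ → E, α 0 = p ∧ ∀ t, HasDerivAt α (f (α t)) t := by
  have hloc : ∀ n : ℕ, ∃ α : ℝ → E, α 0 = p ∧
      ∀ t ∈ Ioo (-((n : ℝ) + 1)) (n + 1), HasDerivAt α (f (α t)) t := by
    intro n
    have h0 : (0 : ℝ) ∈ Icc (-((n : ℝ) + 1)) (n + 1) := by
      constructor <;> linarith [(Nat.cast_nonneg n : (0 : ℝ) ≤ n)]
    have hPL : IsPicardLindelof (fun _ => f) (⟨0, h0⟩ : Icc (-((n : ℝ) + 1)) (n + 1)) p
        (L * (n + 1)) 0 L K :=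
      IsPicardLindelof.of_time_independent (fun q _ => hL q) hf.lipschitzOnWith (by simp)
    obtain ⟨α, hα0, hα⟩ := hPL.exists_eq_forall_mem_Icc_hasDerivWithinAt₀
    exact ⟨α, hα0, fun t ht => (hα t (Ioo_subset_Icc_self ht)).hasDerivAt (Icc_mem_nhds ht.1 ht.2)⟩
  choose α hα0 hα using hloc
  have hagree : ∀ m n : ℕ, m ≤ n → EqOn (α m) (α n) (Ioo (-((m : ℝ) + 1)) (m + 1)) := by
    intro m n hmn
    have hmn' : (m : ℝ) ≤ n := by exact_mod_cast hmn
    have hm0 : (0 : ℝ) ≤ m := Nat.cast_nonneg m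
    refine ODE_solution_unique_of_mem_Ioo (v := fun _ => f) (s := fun _ => univ) (t₀ := 0) (K := K)
      (fun _ _ => hf.lipschitzOnWith) ⟨by linarith, by linarith⟩
      (fun t ht => ⟨hα m t ht, mem_univ _⟩)
      (fun t ht => ⟨hα n t ⟨by linarith [ht.1], by linarith [ht.2]⟩, mem_univ _⟩) ?_
    rw [hα0, hα0]
  have hmem : ∀ t : ℝ, t ∈ Ioo (-((⌈|t|⌉₊ : ℝ) + 1)) (⌈|t|⌉₊ + 1) := by
    intro t
    have := Nat.le_ceil |t|
    have h := abs_le.1 this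
    exact ⟨by linarith [h.1], by linarith [h.2]⟩
  refine ⟨fun t => α ⌈|t|⌉₊ t, by simp [hα0], fun t => ?_⟩
  refine (hα ⌈|t|⌉₊ t (hmem t)).congr_of_eventuallyEq ?_
  filter_upwards [Ioo_mem_nhds (hmem t).1 (hmem t).2] with s hs
  rcases le_total ⌈|s|⌉₊ ⌈|t|⌉₊ with h | h
  · exact hagree _ _ h (hmem s)
  · exact (hagree _ _ h hs).symm

theorem eq_of_hasDerivAt_of_lipschitzWith {f : E → E} {K : ℝ≥0} (hf : LipschitzWith K f)
    {α β : ℝ → E} (hα : ∀ t, HasDerivAt α (f (α t)) t) (hβ : ∀ t, HasDerivAt β (f (β t)) t)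
    {t₀ : ℝ} (h : α t₀ = β t₀) : α = β :=
  ODE_solution_unique_univ (v := fun _ => f) (s := fun _ => univ) (K := K)
    (fun _ => hf.lipschitzOnWith) (fun t => ⟨hα t, mem_univ _⟩) (fun t => ⟨hβ t, mem_univ _⟩) h

/-- Solutions depend jointly continuously on time and on the initial value. -/
theorem continuousOn_uncurry_of_hasDerivAt {f : E → E} {K : ℝ≥0} (hf : LipschitzWith K f)
    {α : E → ℝ → E} (h0 : ∀ p, α p 0 = p) (hα : ∀ p t, HasDerivAt (α p) (f (α p t)) t) (T : ℝ) :
    ContinuousOn (fun q : E × ℝ => α q.1 q.2) (univ ×ˢ Icc 0 T) := by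
  have hcont : ∀ p, Continuous (α p) := fun p =>
    continuous_iff_continuousAt.2 fun t => (hα p t).continuousAt
  refine continuousOn_prod_of_continuousOn_lipschitzOnWith _ (Real.toNNReal (exp (K * T)))
    (fun p _ => (hcont p).continuousOn) fun t ht => LipschitzOnWith.of_dist_le_mul ?_
  intro p _ q _
  have hpq := dist_le_of_trajectories_ODE (v := fun _ => f) (fun _ => hf)
    (hcont p).continuousOn (fun s _ => (hα p s).hasDerivWithinAt)
    (hcont q).continuousOn (fun s _ => (hα q s).hasDerivWithinAt) (le_refl _) t ht
  rw [h0, h0, sub_zero] at hpq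
  rw [Real.coe_toNNReal _ (exp_pos _).le, mul_comm]
  refine hpq.trans ?_
  gcongr
  exact ht.2

end GlobalSolution

/-! ### Comparison lemmas -/

theorem le_cubic_of_hasDerivAt_le {f f' : ℝ → ℝ} {t : ℝ} (ht : 0 ≤ t)
    (hf : ∀ s, HasDerivAt f (f' s) s) (a b c d : ℝ) (h0 : f 0 ≤ a)
    (h : ∀ s ∈ Ico 0 t, f' s ≤ b + 2 * c * s + 3 * d * s ^ 2) :
    f t ≤ a + b * t + c * t ^ 2 + d * t ^ 3 := by
  have hg : ∀ s, HasDerivAt (fun s => a + b * s + c * s ^ 2 + d * s ^ 3 - f s)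
      (b + 2 * c * s + 3 * d * s ^ 2 - f' s) s := by
    intro s
    have h1 := (((hasDerivAt_id s).const_mul b).const_add a).add
      (((hasDerivAt_id s).pow 2).const_mul c)
    have h2 := (h1.add (((hasDerivAt_id s).pow 3).const_mul d)).sub (hf s)
    refine h2.congr_deriv ?_
    simp only [id]
    push_cast
    ring
  have hmono : MonotoneOn (fun s => a + b * s + c * s ^ 2 + d * s ^ 3 - f s) (Icc 0 t) := by
    refine monotoneOn_of_hasDerivWithinAt_nonneg (convex_Icc 0 t)
      (fun s _ => (hg s).continuousAt.continuousWithinAt) (fun s _ => (hg s).hasDerivWithinAt) ?_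
    intro s hs
    rw [interior_Icc] at hs
    linarith [h s (Ioo_subset_Ico_self hs)]
  have := hmono ⟨le_refl 0, ht⟩ ⟨ht, le_refl t⟩ ht
  simp only at this
  linarith

theorem cubic_le_of_le_hasDerivAt {f f' : ℝ → ℝ} {t : ℝ} (ht : 0 ≤ t)
    (hf : ∀ s, HasDerivAt f (f' s) s) (a b c d : ℝ) (h0 : a ≤ f 0)
    (h : ∀ s ∈ Ico 0 t, b + 2 * c * s + 3 * d * s ^ 2 ≤ f' s) :
    a + b * t + c * t ^ 2 + d * t ^ 3 ≤ f t := by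
  have := le_cubic_of_hasDerivAt_le ht (fun s => (hf s).neg) (-a) (-b) (-c) (-d)
    (by simpa using h0) (fun s hs => by linarith [h s hs])
  simp only [Pi.neg_apply] at this
  linarith

/-- Continuity argument: a bound that improves itself holds throughout. -/
theorem lt_of_forall_le_imp_lt {f : ℝ → ℝ} (hf : Continuous f) {m T : ℝ}
    (h : ∀ t ∈ Icc 0 T, (∀ s ∈ Ico 0 t, f s ≤ m) → f t < m) : ∀ t ∈ Icc 0 T, f t < m := by
  intro t ht
  by_contra! hcon
  have hS : IsCompact (Icc 0 t ∩ {s | m ≤ f s}) :=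
    isCompact_Icc.inter_right (isClosed_le continuous_const hf)
  obtain ⟨r, hr⟩ := hS.exists_isLeast ⟨t, ⟨ht.1, le_refl t⟩, hcon⟩
  refine absurd (h r ⟨hr.1.1.1, hr.1.1.2.trans ht.2⟩ fun s hs => ?_) (not_lt.2 hr.1.2)
  by_contra! hs'
  exact absurd (hr.2 ⟨⟨hs.1, hs.2.le.trans hr.1.1.2⟩, hs'.le⟩) (not_le.2 hs.2)

/-! ### The flow in the coordinates `(x, y, v)` with `v = z - π / 2` -/

/-- The 1-1-1 ABC vector field in the coordinates `(x, y, z - π / 2)`. -/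
noncomputable def shiftedABC (p : ℝ × ℝ × ℝ) : ℝ × ℝ × ℝ :=
  (cos p.2.2 + cos p.2.1, sin p.1 - sin p.2.2, sin p.2.1 + cos p.1)

theorem lipschitzWith_shiftedABC : LipschitzWith 2 shiftedABC := by
  have h1 : LipschitzWith 1 fun p : ℝ × ℝ × ℝ => p.1 := LipschitzWith.prod_fst
  have h2 : LipschitzWith 1 fun p : ℝ × ℝ × ℝ => p.2.1 := by
    simpa using! LipschitzWith.prod_fst.comp LipschitzWith.prod_snd
  have h3 : LipschitzWith 1 fun p : ℝ × ℝ × ℝ => p.2.2 := by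
    simpa using! LipschitzWith.prod_snd.comp LipschitzWith.prod_snd
  have e := ((lipschitzWith_cos.comp h3).add (lipschitzWith_cos.comp h2)).prodMk
    (((lipschitzWith_sin.comp h1).sub (lipschitzWith_sin.comp h3)).prodMk
      ((lipschitzWith_sin.comp h2).add (lipschitzWith_cos.comp h1)))
  exact e.weaken (by norm_num)

theorem norm_shiftedABC_le (p : ℝ × ℝ × ℝ) : ‖shiftedABC p‖ ≤ (2 : ℝ≥0) := by
  have hs := fun a : ℝ => And.intro (neg_one_le_sin a) (sin_le_one a)
  have hc := fun a : ℝ => And.intro (neg_one_le_cos a) (cos_le_one a)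
  simp only [shiftedABC, Prod.norm_def, Real.norm_eq_abs, NNReal.coe_ofNat, max_le_iff, abs_le]
  refine ⟨⟨?_, ?_⟩, ⟨?_, ?_⟩, ?_, ?_⟩ <;>
    linarith [hs p.1, hs p.2.1, hs p.2.2, hc p.1, hc p.2.1, hc p.2.2]

/-- A solution of the 1-1-1 ABC flow system in the coordinates `(x, y, z - π / 2)`. -/
def IsShiftedABCSol (x y v : ℝ → ℝ) : Prop :=
  ∀ t : ℝ,
    HasDerivAt x (cos (v t) + cos (y t)) t ∧
    HasDerivAt y (sin (x t) - sin (v t)) t ∧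
    HasDerivAt v (sin (y t) + cos (x t)) t

namespace IsShiftedABCSol

theorem isABCSol {x y v : ℝ → ℝ} (h : IsShiftedABCSol x y v) :
    IsABCSol x y fun t => v t + π / 2 := by
  intro t
  rw [sin_add_pi_div_two, cos_add_pi_div_two, ← sub_eq_add_neg]
  exact ⟨(h t).1, (h t).2.1, (h t).2.2.add_const _⟩

theorem of_hasDerivAt {α : ℝ → ℝ × ℝ × ℝ} (h : ∀ t, HasDerivAt α (shiftedABC (α t)) t) :
    IsShiftedABCSol (fun t => (α t).1) (fun t => (α t).2.1) (fun t => (α t).2.2) := fun t =>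
  ⟨(h t).fst, (h t).snd.fst, (h t).snd.snd⟩

theorem eq_of_eq {x y v x' y' v' : ℝ → ℝ} (h : IsShiftedABCSol x y v)
    (h' : IsShiftedABCSol x' y' v') {t₀ : ℝ} (hx : x t₀ = x' t₀) (hy : y t₀ = y' t₀)
    (hv : v t₀ = v' t₀) (t : ℝ) : x t = x' t ∧ y t = y' t ∧ v t = v' t := by
  have := eq_of_hasDerivAt_of_lipschitzWith lipschitzWith_shiftedABC
    (α := fun t => (x t, y t, v t)) (β := fun t => (x' t, y' t, v' t)) (t₀ := t₀)
    (fun t => (h t).1.prodMk ((h t).2.1.prodMk (h t).2.2))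
    (fun t => (h' t).1.prodMk ((h' t).2.1.prodMk (h' t).2.2)) (by simp [hx, hy, hv])
  simpa using congrFun this t

/-- The time-reversing symmetry `(x, y, v) ↦ (-x, y, -v)`. -/
theorem reflect {x y v : ℝ → ℝ} (h : IsShiftedABCSol x y v) :
    IsShiftedABCSol (fun t => -x (-t)) (fun t => y (-t)) (fun t => -v (-t)) := by
  intro t
  have hn : HasDerivAt (fun t : ℝ => -t) (-1) t := hasDerivAt_neg t
  refine ⟨?_, ?_, ?_⟩
  · refine (((h (-t)).1.comp t hn).neg).congr_deriv ?_
    simp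
  · refine ((h (-t)).2.1.comp t hn).congr_deriv ?_
    simp
    ring
  · refine (((h (-t)).2.2.comp t hn).neg).congr_deriv ?_
    simp

/-- The time-reversing symmetry `(x, y, v) ↦ (π / 2 - x, -v, -y)`. -/
theorem reflect_diag {x y v : ℝ → ℝ} (h : IsShiftedABCSol x y v) (c : ℝ) :
    IsShiftedABCSol (fun t => π / 2 - x (c - t)) (fun t => -v (c - t))
      (fun t => -y (c - t)) := by
  intro t
  have hn : HasDerivAt (fun t : ℝ => c - t) (-1) t := by
    simpa using (hasDerivAt_id t).const_sub c
  refine ⟨?_, ?_, ?_⟩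
  · refine (((h (c - t)).1.comp t hn).const_sub (π / 2)).congr_deriv ?_
    simp
    ring
  · refine (((h (c - t)).2.2.comp t hn).neg).congr_deriv ?_
    simp [sin_pi_div_two_sub]
    ring
  · refine (((h (c - t)).2.1.comp t hn).neg).congr_deriv ?_
    simp [cos_pi_div_two_sub]
    ring

/-- An orbit joining the symmetry lines of the two reversing symmetries is a helix. -/
theorem map_add_eq {x y v : ℝ → ℝ} (h : IsShiftedABCSol x y v) (hx0 : x 0 = 0) (hv0 : v 0 = 0)
    {τ : ℝ} (hxτ : x τ = π / 4) (hτ : y τ + v τ = 0) (t : ℝ) :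
    x (t + 2 * τ) = x t + π / 2 := by
  have h1 := (h.eq_of_eq h.reflect (t₀ := 0) (by simp [hx0]) (by simp) (by simp [hv0]) t).1
  have h2 := (h.eq_of_eq (h.reflect_diag (2 * τ)) (t₀ := τ)
    (by rw [show 2 * τ - τ = τ by ring, hxτ]; ring)
    (by rw [show 2 * τ - τ = τ by ring]; linarith)
    (by rw [show 2 * τ - τ = τ by ring]; linarith) (t + 2 * τ)).1
  rw [h2, h1, show 2 * τ - (t + 2 * τ) = -t by ring]
  ring

end IsShiftedABCSol

/-! ### A priori estimates near the axis -/

theorem seven_ninths_le_cos {a : ℝ} (ha : |a| ≤ 2 / 3) : 7 / 9 ≤ cos a := by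
  have h1 := one_sub_sq_div_two_le_cos (x := a)
  have h2 := abs_le.1 ha
  nlinarith

namespace IsShiftedABCSol

/-- Estimates valid as long as `y` and `v` stay in `[-2/3, 2/3]`. -/
theorem estimates_of_abs_le {x y v : ℝ → ℝ} (h : IsShiftedABCSol x y v) (hx0 : x 0 = 0)
    (hy0 : y 0 ∈ Icc (-1 / 2 : ℝ) 0) (hv0 : v 0 = 0) {t : ℝ} (ht : t ∈ Icc (0 : ℝ) 0.51)
    (hm : ∀ s ∈ Ico 0 t, |y s| ≤ 2 / 3 ∧ |v s| ≤ 2 / 3) :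
    (14 / 9 * t ≤ x t ∧ x t ≤ 2 * t) ∧ (0 ≤ v t ∧ v t ≤ t + t ^ 3 / 3) ∧
      y 0 - 5 / 9 * t ^ 2 ≤ y t ∧ y t ≤ y 0 + t ^ 2 := by
  obtain ⟨ht0, ht1⟩ := ht
  norm_num at ht1
  have hpi := pi_gt_three
  have hx : ∀ s ∈ Icc 0 t, 14 / 9 * s ≤ x s ∧ x s ≤ 2 * s := by
    intro s hs
    have hlow := cubic_le_of_le_hasDerivAt hs.1 (fun r => (h r).1) 0 (14 / 9) 0 0 hx0.ge
      fun r hr => by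
        have hr' := hm r ⟨hr.1, hr.2.trans_le hs.2⟩
        linarith [seven_ninths_le_cos hr'.1, seven_ninths_le_cos hr'.2]
    have hupp := le_cubic_of_hasDerivAt_le hs.1 (fun r => (h r).1) 0 2 0 0 hx0.le
      fun r _ => by linarith [cos_le_one (v r), cos_le_one (y r)]
    constructor <;> linarith
  have hvlow : ∀ s ∈ Icc 0 t, 0 ≤ v s := by
    intro s hs
    have hlow := cubic_le_of_le_hasDerivAt hs.1 (fun r => (h r).2.2) 0 (1 / 3) 0 (-2 / 3) hv0.ge
      fun r hr => by
        have hxr := hx r ⟨hr.1, hr.2.le.trans hs.2⟩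
        have h1 := one_sub_sq_div_two_le_cos (x := x r)
        have h2 : -(2 / 3) ≤ sin (y r) := by
          have := abs_sin_le_abs (x := y r)
          linarith [neg_abs_le (sin (y r)), (hm r ⟨hr.1, hr.2.trans_le hs.2⟩).1]
        nlinarith [hr.1]
    have hs2 : s ^ 2 ≤ 1 / 2 := by nlinarith [hs.1, hs.2]
    nlinarith [hs.1]
  have hyupp : ∀ s ∈ Icc 0 t, y s ≤ y 0 + s ^ 2 := by
    intro s hs
    have hupp := le_cubic_of_hasDerivAt_le hs.1 (fun r => (h r).2.1) (y 0) 0 1 0 le_rfl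
      fun r hr => by
        have hr' := abs_le.1 (hm r ⟨hr.1, hr.2.trans_le hs.2⟩).2
        have hxr := hx r ⟨hr.1, hr.2.le.trans hs.2⟩
        have h1 := sin_nonneg_of_nonneg_of_le_pi (hvlow r ⟨hr.1, hr.2.le.trans hs.2⟩)
          (by linarith)
        have h2 := sin_le (x := x r) (by linarith [hr.1])
        linarith
    linarith
  have hvupp : ∀ s ∈ Icc 0 t, v s ≤ s + s ^ 3 / 3 := by
    intro s hs
    have hupp := le_cubic_of_hasDerivAt_le hs.1 (fun r => (h r).2.2) 0 1 0 (1 / 3) hv0.le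
      fun r hr => by
        have hr' := abs_le.1 (hm r ⟨hr.1, hr.2.trans_le hs.2⟩).1
        have hyr := hyupp r ⟨hr.1, hr.2.le.trans hs.2⟩
        have h1 : sin (y r) ≤ r ^ 2 := by
          rcases le_total 0 (y r) with hy | hy
          · linarith [sin_le hy, hy0.2]
          · linarith [sin_nonpos_of_nonpos_of_neg_pi_le hy (by linarith), sq_nonneg r]
        linarith [cos_le_one (x r)]
    linarith
  have hylow : ∀ s ∈ Icc 0 t, y 0 - 5 / 9 * s ^ 2 ≤ y s := by
    intro s hs
    have hlow := cubic_le_of_le_hasDerivAt hs.1 (fun r => (h r).2.1) (y 0) 0 (-5 / 9) 0 le_rfl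
      fun r hr => by
        have hr' : r ∈ Icc 0 t := ⟨hr.1, hr.2.le.trans hs.2⟩
        have h1 := sin_le (hvlow r hr')
        have h2 := hvupp r hr'
        have h3 := hx r hr'
        have h4 := sin_nonneg_of_nonneg_of_le_pi (x := x r) (by linarith [hr.1])
          (by linarith [hr'.2])
        have h5 : r ^ 2 ≤ 1 / 3 := by nlinarith [hr'.1, hr'.2]
        nlinarith [hr'.1]
    linarith
  have htt : t ∈ Icc 0 t := ⟨ht0, le_refl t⟩
  exact ⟨hx t htt, ⟨hvlow t htt, hvupp t htt⟩, hylow t htt, hyupp t htt⟩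

/-- Up to time `0.51` the orbit stays close to the axis `y = v = 0`. -/
theorem abs_lt {x y v : ℝ → ℝ} (h : IsShiftedABCSol x y v) (hx0 : x 0 = 0)
    (hy0 : y 0 ∈ Icc (-1 / 2 : ℝ) 0) (hv0 : v 0 = 0) :
    ∀ t ∈ Icc (0 : ℝ) 0.51, |y t| < 2 / 3 ∧ |v t| < 2 / 3 := by
  have hyc : Continuous y := continuous_iff_continuousAt.2 fun t => (h t).2.1.continuousAt
  have hvc : Continuous v := continuous_iff_continuousAt.2 fun t => (h t).2.2.continuousAt
  simp_rw [← max_lt_iff]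
  refine lt_of_forall_le_imp_lt (f := fun t => max |y t| |v t|) (by fun_prop) fun t ht hm => ?_
  have hest := h.estimates_of_abs_le hx0 hy0 hv0 ht fun s hs => max_le_iff.1 (hm s hs)
  obtain ⟨_, ⟨hv1, hv2⟩, hy1, hy2⟩ := hest
  obtain ⟨ht0, ht1⟩ := ht
  norm_num at ht1
  have ht2 : t ^ 2 ≤ 0.2601 := by nlinarith
  have ht3 : t ^ 3 ≤ 0.14 := by nlinarith
  norm_num at ht2 ht3
  rw [max_lt_iff, _root_.abs_lt, _root_.abs_lt]
  refine ⟨⟨?_, ?_⟩, ?_, ?_⟩ <;> linarith [hy0.1, hy0.2]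

theorem estimates {x y v : ℝ → ℝ} (h : IsShiftedABCSol x y v) (hx0 : x 0 = 0)
    (hy0 : y 0 ∈ Icc (-1 / 2 : ℝ) 0) (hv0 : v 0 = 0) {t : ℝ} (ht : t ∈ Icc (0 : ℝ) 0.51) :
    (14 / 9 * t ≤ x t ∧ x t ≤ 2 * t) ∧ (0 ≤ v t ∧ v t ≤ t + t ^ 3 / 3) ∧
      y 0 - 5 / 9 * t ^ 2 ≤ y t ∧ y t ≤ y 0 + t ^ 2 :=
  h.estimates_of_abs_le hx0 hy0 hv0 ht fun s hs =>
    have hs' := h.abs_lt hx0 hy0 hv0 s ⟨hs.1, hs.2.le.trans ht.2⟩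
    ⟨hs'.1.le, hs'.2.le⟩

theorem strictMonoOn {x y v : ℝ → ℝ} (h : IsShiftedABCSol x y v) (hx0 : x 0 = 0)
    (hy0 : y 0 ∈ Icc (-1 / 2 : ℝ) 0) (hv0 : v 0 = 0) : StrictMonoOn x (Icc 0 0.51) := by
  refine strictMonoOn_of_hasDerivWithinAt_pos (convex_Icc _ _)
    (fun t _ => (h t).1.continuousAt.continuousWithinAt) (fun t _ => (h t).1.hasDerivWithinAt) ?_
  intro t ht
  have ht' := h.abs_lt hx0 hy0 hv0 t (interior_subset ht)
  linarith [seven_ninths_le_cos ht'.1.le, seven_ninths_le_cos ht'.2.le]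

theorem exists_eq_pi_div_four {x y v : ℝ → ℝ} (h : IsShiftedABCSol x y v) (hx0 : x 0 = 0)
    (hy0 : y 0 ∈ Icc (-1 / 2 : ℝ) 0) (hv0 : v 0 = 0) :
    ∃ t ∈ Icc (0 : ℝ) 0.51, x t = π / 4 := by
  have hxc : Continuous x := continuous_iff_continuousAt.2 fun t => (h t).1.continuousAt
  have hend := (h.estimates hx0 hy0 hv0 (t := 0.51) ⟨by norm_num, le_rfl⟩).1.1
  have hpi := pi_lt_d2
  refine intermediate_value_Icc (by norm_num) hxc.continuousOn ⟨?_, ?_⟩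
  · rw [hx0]; positivity
  · norm_num at hend hpi ⊢
    linarith

/-- Starting from `y = 0`, the orbit stays in the half space `0 ≤ y + v`. -/
theorem add_nonneg_of_eq_zero {x y v : ℝ → ℝ} (h : IsShiftedABCSol x y v) (hx0 : x 0 = 0)
    (hy0 : y 0 = 0) (hv0 : v 0 = 0) {t : ℝ} (ht : t ∈ Icc (0 : ℝ) 0.51) : 0 ≤ y t + v t := by
  have hy0' : y 0 ∈ Icc (-1 / 2 : ℝ) 0 := by rw [hy0]; norm_num
  have hlow := cubic_le_of_le_hasDerivAt ht.1 (fun r => (h r).2.1.add (h r).2.2) 0 0 0 0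
    (by simp [hy0, hv0]) fun r hr => by
      have hr' : r ∈ Icc (0 : ℝ) 0.51 := ⟨hr.1, hr.2.le.trans ht.2⟩
      obtain ⟨⟨hx1, hx2⟩, ⟨hv1, hv2⟩, hy1, hy2⟩ := h.estimates hx0 hy0' hv0 hr'
      obtain ⟨hr0, hr1⟩ := hr'
      norm_num at hr1
      have hpi := pi_gt_three
      have hsin := sin_nonneg_of_nonneg_of_le_pi (x := x r) (by linarith) (by linarith)
      have hcos := cos_nonneg_of_mem_Icc (x := x r) ⟨by linarith, by linarith⟩
      have hsum : 1 ≤ sin (x r) + cos (x r) := by nlinarith [sin_sq_add_cos_sq (x r)]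
      have hsv := sin_le hv1
      have hr2 : r ^ 2 ≤ 0.2601 := by nlinarith
      have hr3 : r ^ 3 ≤ 0.14 := by nlinarith
      norm_num at hr2 hr3
      have hsy : -(1 / 3) ≤ sin (y r) := by
        have habs : |y r| ≤ 1 / 3 := abs_le.2 ⟨by linarith, by linarith⟩
        linarith [neg_abs_le (sin (y r)), abs_sin_le_abs (x := y r)]
      linarith
  simp only [Pi.add_apply] at hlow
  linarith

/-- Starting from `y = -1/2`, the orbit reaches `x = π / 4` in the half space `y + v ≤ 0`. -/
theorem add_nonpos_of_eq_neg_half {x y v : ℝ → ℝ} (h : IsShiftedABCSol x y v) (hx0 : x 0 = 0)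
    (hy0 : y 0 = -1 / 2) (hv0 : v 0 = 0) {t : ℝ} (ht : t ∈ Icc (0 : ℝ) 0.51)
    (hxt : x t = π / 4) : y t + v t ≤ 0 := by
  have hy0' : y 0 ∈ Icc (-1 / 2 : ℝ) 0 := by rw [hy0]; norm_num
  have hvupp : ∀ s ∈ Icc 0 t, v s ≤ 17 / 32 * s + 5 / 16 * s ^ 3 := by
    intro s hs
    have hupp := le_cubic_of_hasDerivAt_le hs.1 (fun r => (h r).2.2) 0 (17 / 32) 0 (5 / 16) hv0.le
      fun r hr => by
        have hr' : r ∈ Icc (0 : ℝ) 0.51 := ⟨hr.1, hr.2.le.trans (hs.2.trans ht.2)⟩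
        obtain ⟨-, -, hy1, hy2⟩ := h.estimates hx0 hy0' hv0 hr'
        obtain ⟨hr0, hr1⟩ := hr'
        norm_num at hr1
        have hr2 : r ^ 2 ≤ 0.2601 := by nlinarith
        norm_num at hr2
        have hpi := pi_gt_three
        have hw := sin_gt_sub_cube (x := 1 / 2 - r ^ 2) (by linarith)
        have hmono := sin_le_sin_of_le_of_le_pi_div_two (x := y r) (y := -(1 / 2 - r ^ 2))
          (by linarith) (by nlinarith) (by linarith)
        rw [sin_neg] at hmono
        have hcube : (1 / 2 - r ^ 2) ^ 3 ≤ 1 / 4 * (1 / 2 - r ^ 2) := by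
          have hw0 : 0 ≤ 1 / 2 - r ^ 2 := by linarith
          have hw2 : (1 / 2 - r ^ 2) ^ 2 ≤ 1 / 4 := by nlinarith [sq_nonneg r]
          nlinarith
        linarith [cos_le_one (x r)]
    linarith
  have hxlow := cubic_le_of_le_hasDerivAt ht.1 (fun r => (h r).1) 0 (19 / 20 + 7 / 9) 0 0 hx0.ge
    fun r hr => by
      have hr' : r ∈ Icc (0 : ℝ) 0.51 := ⟨hr.1, hr.2.le.trans ht.2⟩
      have hyr := seven_ninths_le_cos (h.abs_lt hx0 hy0' hv0 r hr').1.le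
      have hv1 := (h.estimates hx0 hy0' hv0 hr').2.1.1
      have hv2 := hvupp r ⟨hr.1, hr.2.le⟩
      obtain ⟨hr0, hr1⟩ := hr'
      norm_num at hr1
      have hr2 : r ^ 2 ≤ 0.2601 := by nlinarith
      have hr3 : r ^ 3 ≤ 0.1327 := by nlinarith
      norm_num at hr2 hr3
      have hv3 : v r ≤ 0.3125 := by norm_num; linarith
      norm_num at hv3
      have hcos := one_sub_sq_div_two_le_cos (x := v r)
      nlinarith
  rw [hxt] at hxlow
  have hpi := pi_lt_d4
  norm_num at hpi
  have htτ : t ≤ 0.455 := by norm_num; linarith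
  norm_num at htτ
  have ht2 : t ^ 2 ≤ 0.2071 := by nlinarith [ht.1]
  have ht3 : t ^ 3 ≤ 0.0943 := by nlinarith [ht.1]
  norm_num at ht2 ht3
  have hy := (h.estimates hx0 hy0' hv0 ht).2.2.2
  have hv := hvupp t ⟨ht.1, le_rfl⟩
  linarith

end IsShiftedABCSol

/-! ### Shooting between the symmetry lines -/

theorem exists_isShiftedABCSol_joining_symmetry_lines :
    ∃ x y v : ℝ → ℝ, IsShiftedABCSol x y v ∧ x 0 = 0 ∧ v 0 = 0 ∧
      ∃ τ > 0, x τ = π / 4 ∧ y τ + v τ = 0 := by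
  choose α hα0 hα using exists_hasDerivAt_of_lipschitzWith_of_bounded lipschitzWith_shiftedABC
    norm_shiftedABC_le
  set β : ℝ → ℝ → ℝ × ℝ × ℝ := fun a => α (0, a, 0)
  have hsol : ∀ a, IsShiftedABCSol (fun t => (β a t).1) (fun t => (β a t).2.1)
      (fun t => (β a t).2.2) := fun a => .of_hasDerivAt (hα _)
  have hβ0 : ∀ a, β a 0 = (0, a, 0) := fun a => hα0 _
  have hcont : ContinuousOn (fun q : ℝ × ℝ => β q.1 q.2)
      (Icc (-1 / 2 : ℝ) 0 ×ˢ Icc (0 : ℝ) 0.51) :=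
    (continuousOn_uncurry_of_hasDerivAt lipschitzWith_shiftedABC hα0 hα 0.51).comp
      (f := fun q : ℝ × ℝ => (((0 : ℝ), q.1, (0 : ℝ)), q.2)) (by fun_prop)
      fun q hq => ⟨mem_univ _, hq.2⟩
  have hclosed : ∀ C : Set (ℝ × ℝ × ℝ), IsClosed C →
      IsClosed {a | ∃ t, (a ∈ Icc (-1 / 2 : ℝ) 0 ∧ t ∈ Icc (0 : ℝ) 0.51) ∧ β a t ∈ C} := by
    intro C hC
    have hK : IsCompact (Icc (-1 / 2 : ℝ) 0 ×ˢ Icc (0 : ℝ) 0.51) :=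
      isCompact_Icc.prod isCompact_Icc
    have := (hK.of_isClosed_subset (hcont.preimage_isClosed_of_isClosed hK.isClosed hC)
      inter_subset_left).image continuous_fst
    convert this.isClosed using 1
    ext a
    simp only [mem_image, mem_inter_iff, mem_prod, Prod.exists, exists_and_right, exists_eq_right,
      mem_preimage, mem_ofPred_eq]
  have hx : ∀ a, (β a 0).1 = 0 := fun a => by rw [hβ0]
  have hy : ∀ a, (β a 0).2.1 = a := fun a => by rw [hβ0]
  have hv : ∀ a, (β a 0).2.2 = 0 := fun a => by rw [hβ0]
  have hhit : ∀ a ∈ Icc (-1 / 2 : ℝ) 0, ∃ t ∈ Icc (0 : ℝ) 0.51, (β a t).1 = π / 4 := fun a ha =>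
    (hsol a).exists_eq_pi_div_four (hx a) (by simpa only [hy] using ha) (hv a)
  have hleft : (-1 / 2 : ℝ) ∈ Icc (-1 / 2 : ℝ) 0 := by norm_num
  have hright : (0 : ℝ) ∈ Icc (-1 / 2 : ℝ) 0 := by norm_num
  have hadd : Continuous fun p : ℝ × ℝ × ℝ => p.2.1 + p.2.2 := by fun_prop
  obtain ⟨a, ha, ⟨t, ⟨-, ht⟩, hxt, hpos⟩, s, ⟨-, hs⟩, hxs, hneg⟩ :=
    isPreconnected_closed_iff.1 (isPreconnected_Icc (a := (-1 / 2 : ℝ)) (b := 0)) _ _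
      (hclosed {p | p.1 = π / 4 ∧ 0 ≤ p.2.1 + p.2.2}
        ((isClosed_eq continuous_fst continuous_const).inter
          (isClosed_le continuous_const hadd)))
      (hclosed {p | p.1 = π / 4 ∧ p.2.1 + p.2.2 ≤ 0}
        ((isClosed_eq continuous_fst continuous_const).inter
          (isClosed_le hadd continuous_const)))
      (fun a ha => by
        obtain ⟨t, ht, hxt⟩ := hhit a ha
        exact (le_total 0 ((β a t).2.1 + (β a t).2.2)).imp (fun h => ⟨t, ⟨ha, ht⟩, hxt, h⟩)
          fun h => ⟨t, ⟨ha, ht⟩, hxt, h⟩)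
      (by
        obtain ⟨t, ht, hxt⟩ := hhit 0 hright
        exact ⟨0, hright, t, ⟨hright, ht⟩, hxt,
          (hsol 0).add_nonneg_of_eq_zero (hx _) (hy _) (hv _) ht⟩)
      (by
        obtain ⟨t, ht, hxt⟩ := hhit _ hleft
        exact ⟨_, hleft, t, ⟨hleft, ht⟩, hxt,
          (hsol _).add_nonpos_of_eq_neg_half (hx _) (hy _) (hv _) ht hxt⟩)
  have hts : t = s := ((hsol a).strictMonoOn (hx a) (by simpa only [hy] using ha) (hv a)).injOn
    ht hs (hxt.trans hxs.symm)
  subst hts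
  refine ⟨_, _, _, hsol a, hx a, hv a, t, ht.1.lt_of_ne ?_, hxt, le_antisymm hneg hpos⟩
  rintro rfl
  linarith [pi_pos, hx a]

theorem tendsto_div_atTop_of_map_add_eq {f : ℝ → ℝ} (hf : Continuous f) {P d : ℝ} (hP : P ≠ 0)
    (h : ∀ t, f (t + P) = f t + d) : Tendsto (fun t => f t / t) atTop (nhds (d / P)) := by
  have hper : Function.Periodic (fun t => f t - d / P * t) P := by
    intro t
    simp only [h]
    field_simp
    ring
  obtain ⟨C, hC⟩ := (hper.isBounded_of_continuous hP (by fun_prop)).exists_norm_le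
  have hzero : Tendsto (fun t => (f t - d / P * t) / t) atTop (nhds 0) := by
    refine squeeze_zero_norm' ?_ ((tendsto_const_nhds (x := C)).div_atTop tendsto_id)
    filter_upwards [eventually_gt_atTop 0] with t ht
    rw [norm_div, Real.norm_of_nonneg ht.le]
    exact div_le_div_of_nonneg_right (hC _ ⟨t, rfl⟩) ht.le
  refine (by simpa using hzero.add_const (d / P) :
    Tendsto (fun t => (f t - d / P * t) / t + d / P) atTop (nhds (d / P))).congr' ?_
  filter_upwards [eventually_gt_atTop 0] with t ht
  field_simp
  ring

theorem stmt18 :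
    ∃ x y z : ℝ → ℝ, IsABCSol x y z ∧ ∃ c > (0 : ℝ),
      Filter.Tendsto (fun t => x t / t) Filter.atTop (nhds c) := by
  obtain ⟨x, y, v, h, hx0, hv0, τ, hτ, hxτ, hyv⟩ := exists_isShiftedABCSol_joining_symmetry_lines
  exact ⟨x, y, _, h.isABCSol, π / 2 / (2 * τ), by positivity,
    tendsto_div_atTop_of_map_add_eq
      (continuous_iff_continuousAt.2 fun t => (h t).1.continuousAt) (by positivity)
      (h.map_add_eq hx0 hv0 hxτ hyv)⟩
end

section
/- For every nonzero vector p ∈ ℝ³ there exists a solution X : ℝ → ℝ³ of the 1-1-1 ABC flow system such that limsup_{t → ∞} (p · X(t))/t > 0, where p · X(t) denotes the Euclidean inner product. -/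
open Real Set Filter

open scoped NNReal Topology

/-- A bounded Lipschitz autonomous vector field has a global integral curve through every point. -/
theorem exists_global_solution_of_bounded_lipschitz {E : Type*} [NormedAddCommGroup E]
    [NormedSpace ℝ E] [CompleteSpace E] {v : E → E} {K L : ℝ≥0} (hv : LipschitzWith K v)
    (hL : ∀ q, ‖v q‖ ≤ L) (q₀ : E) :
    ∃ X : ℝ → E, X 0 = q₀ ∧ ∀ t, HasDerivAt X (v (X t)) t := by
  have hlocal (n : ℕ) : ∃ X : ℝ → E, X 0 = q₀ ∧
      ∀ t ∈ Ioo (-(n + 1 : ℝ)) (n + 1), HasDerivAt X (v (X t)) t := by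
    have hn : (0 : ℝ) ≤ n := Nat.cast_nonneg n
    have hPL : IsPicardLindelof (fun _ ↦ v) (tmin := -(n + 1 : ℝ)) (tmax := n + 1)
        ⟨0, by constructor <;> linarith⟩ q₀ (L * (n + 1)) 0 L K :=
      IsPicardLindelof.of_time_independent (fun q _ ↦ hL q) hv.lipschitzOnWith (by simp)
    obtain ⟨X, hX0, hX⟩ := hPL.exists_eq_forall_mem_Icc_hasDerivWithinAt₀
    exact ⟨X, hX0, fun t ht ↦
      (hX t (Ioo_subset_Icc_self ht)).hasDerivAt (Icc_mem_nhds ht.1 ht.2)⟩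
  choose Y hY0 hY using hlocal
  have hagree (m n : ℕ) (hmn : m ≤ n) : EqOn (Y m) (Y n) (Ioo (-(m + 1 : ℝ)) (m + 1)) := by
    have hm : (0 : ℝ) ≤ m := Nat.cast_nonneg m
    have hmn' : (m : ℝ) ≤ n := Nat.cast_le.2 hmn
    refine ODE_solution_unique_of_mem_Ioo (v := fun _ ↦ v) (s := fun _ ↦ univ) (t₀ := 0)
      (fun _ _ ↦ hv.lipschitzOnWith) ⟨by linarith, by linarith⟩
      (fun t ht ↦ ⟨hY m t ht, trivial⟩)
      (fun t ht ↦ ⟨hY n t ⟨by linarith [ht.1], by linarith [ht.2]⟩, trivial⟩) ?_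
    rw [hY0, hY0]
  refine ⟨fun t ↦ Y ⌈|t|⌉₊ t, hY0 _, fun t ↦ ?_⟩
  have hmem (s : ℝ) : s ∈ Ioo (-(⌈|s|⌉₊ + 1 : ℝ)) (⌈|s|⌉₊ + 1) := by
    have := Nat.le_ceil |s|
    exact ⟨by linarith [neg_abs_le s], by linarith [le_abs_self s]⟩
  refine (hY ⌈|t|⌉₊ t (hmem t)).congr_of_eventuallyEq ?_
  filter_upwards [Ioo_mem_nhds (hmem t).1 (hmem t).2] with s hs
  rcases le_total ⌈|s|⌉₊ ⌈|t|⌉₊ with h | h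
  · exact hagree _ _ h (hmem s)
  · exact (hagree _ _ h hs).symm

/-- The ABC vector field in the coordinates `(x, y, w)` with `z = w + π / 2`, whose first component
is truncated from below at `c`. -/
noncomputable def truncatedField (c : ℝ) (q : ℝ × ℝ × ℝ) : ℝ × ℝ × ℝ :=
  (max (cos q.2.2 + cos q.2.1) c, sin q.1 - sin q.2.2, sin q.2.1 + cos q.1)

theorem lipschitzWith_truncatedField (c : ℝ) : LipschitzWith 2 (truncatedField c) := by
  refine LipschitzWith.of_dist_le_mul fun p q ↦ ?_
  have hx : |p.1 - q.1| ≤ dist p q := le_max_left _ _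
  have hy : |p.2.1 - q.2.1| ≤ dist p q := (le_max_left _ _).trans (le_max_right _ _)
  have hw : |p.2.2 - q.2.2| ≤ dist p q := (le_max_right _ _).trans (le_max_right _ _)
  have hsx := abs_le.1 ((abs_sin_sub_sin_le p.1 q.1).trans hx)
  have hsy := abs_le.1 ((abs_sin_sub_sin_le p.2.1 q.2.1).trans hy)
  have hsw := abs_le.1 ((abs_sin_sub_sin_le p.2.2 q.2.2).trans hw)
  have hcx := abs_le.1 ((abs_cos_sub_cos_le p.1 q.1).trans hx)
  have hcy := abs_le.1 ((abs_cos_sub_cos_le p.2.1 q.2.1).trans hy)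
  have hcw := abs_le.1 ((abs_cos_sub_cos_le p.2.2 q.2.2).trans hw)
  rw [Prod.dist_eq, Prod.dist_eq, NNReal.coe_ofNat, max_le_iff, max_le_iff]
  simp only [truncatedField, Real.dist_eq]
  refine ⟨(abs_max_sub_max_le_abs _ _ _).trans ?_, ?_, ?_⟩ <;> rw [abs_le] <;>
    constructor <;> linarith

theorem norm_truncatedField_le {c : ℝ} (hc : |c| ≤ 2) (q : ℝ × ℝ × ℝ) :
    ‖truncatedField c q‖ ≤ 2 := by
  have hc' := abs_le.1 hc
  have := neg_one_le_cos q.2.2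
  have := neg_one_le_cos q.2.1
  have := neg_one_le_cos q.1
  have := neg_one_le_sin q.2.2
  have := neg_one_le_sin q.2.1
  have := neg_one_le_sin q.1
  have := cos_le_one q.2.2
  have := cos_le_one q.2.1
  have := cos_le_one q.1
  have := sin_le_one q.2.2
  have := sin_le_one q.2.1
  have := sin_le_one q.1
  simp only [Prod.norm_def, truncatedField, Real.norm_eq_abs, max_le_iff, abs_le]
  refine ⟨⟨le_max_of_le_left ?_, ?_, ?_⟩, ⟨?_, ?_⟩, ?_, ?_⟩ <;> linarith

theorem exists_truncatedField_solution {c : ℝ} (hc : |c| ≤ 2) (q₀ : ℝ × ℝ × ℝ) :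
    ∃ X : ℝ → ℝ × ℝ × ℝ, X 0 = q₀ ∧ ∀ t, HasDerivAt X (truncatedField c (X t)) t :=
  exists_global_solution_of_bounded_lipschitz (L := 2) (lipschitzWith_truncatedField c)
    (norm_truncatedField_le hc) q₀

theorem HasDerivAt.prod_coords {X : ℝ → ℝ × ℝ × ℝ} {d : ℝ × ℝ × ℝ} {t : ℝ}
    (h : HasDerivAt X d t) :
    HasDerivAt (fun s ↦ (X s).1) d.1 t ∧ HasDerivAt (fun s ↦ (X s).2.1) d.2.1 t ∧
      HasDerivAt (fun s ↦ (X s).2.2) d.2.2 t := by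
  have h2 := h.hasFDerivAt.snd.hasDerivAt
  refine ⟨?_, ?_, ?_⟩
  · simpa using h.hasFDerivAt.fst.hasDerivAt
  · simpa using h2.hasFDerivAt.fst.hasDerivAt
  · simpa using h2.hasFDerivAt.snd.hasDerivAt

theorem le_of_hasDerivAt_nonneg {f f' : ℝ → ℝ} {a b : ℝ} (hab : a ≤ b)
    (hf : ∀ t, HasDerivAt f (f' t) t) (hf' : ∀ t ∈ Icc a b, 0 ≤ f' t) : f a ≤ f b := by
  refine monotoneOn_of_deriv_nonneg (convex_Icc a b)
    (fun t _ ↦ (hf t).continuousAt.continuousWithinAt)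
    (fun t _ ↦ (hf t).differentiableAt.differentiableWithinAt) (fun t ht ↦ ?_)
    (left_mem_Icc.2 hab) (right_mem_Icc.2 hab) hab
  rw [(hf t).deriv]
  exact hf' t (interior_subset ht)

section TruncatedTrajectory

variable {x y w : ℝ → ℝ}

/-- A trajectory of the vector field truncated at speed `1`. -/
structure IsTruncatedTrajectory (x y w : ℝ → ℝ) : Prop where
  hasDerivAt_x : ∀ t, HasDerivAt x (max (cos (w t) + cos (y t)) 1) t
  hasDerivAt_y : ∀ t, HasDerivAt y (sin (x t) - sin (w t)) t
  hasDerivAt_w : ∀ t, HasDerivAt w (sin (y t) + cos (x t)) t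

namespace IsTruncatedTrajectory

theorem time_le_x_sub (h : IsTruncatedTrajectory x y w) {s t : ℝ} (hst : s ≤ t) :
    t - s ≤ x t - x s := by
  have := le_of_hasDerivAt_nonneg hst
    (fun r ↦ (h.hasDerivAt_x r).sub (hasDerivAt_id r))
    (fun r _ ↦ sub_nonneg.2 (le_max_right _ _))
  simp only [Pi.sub_apply, id] at this
  linarith

theorem y_add_x_add_cos_mono (h : IsTruncatedTrajectory x y w) {s t : ℝ} (hst : s ≤ t) :
    y s + x s + cos (x s) ≤ y t + x t + cos (x t) := by
  refine le_of_hasDerivAt_nonneg hst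
    (fun r ↦ ((h.hasDerivAt_y r).add (h.hasDerivAt_x r)).add (h.hasDerivAt_x r).cos)
    (fun r _ ↦ ?_)
  have hV := le_max_right (cos (w r) + cos (y r)) 1
  nlinarith [sin_le_one (x r), sin_le_one (w r)]

theorem y_sub_x_add_cos_anti (h : IsTruncatedTrajectory x y w) {s t : ℝ} (hst : s ≤ t) :
    y t - x t + cos (x t) ≤ y s - x s + cos (x s) := by
  have := le_of_hasDerivAt_nonneg hst
    (fun r ↦ ((h.hasDerivAt_x r).sub (h.hasDerivAt_y r)).sub (h.hasDerivAt_x r).cos)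
    (fun r _ ↦ by
      have hV := le_max_right (cos (w r) + cos (y r)) 1
      nlinarith [neg_one_le_sin (x r), neg_one_le_sin (w r)])
  simp only [Pi.sub_apply] at this
  linarith

theorem w_add_x_sub_sin_mono (h : IsTruncatedTrajectory x y w) {s t : ℝ} (hst : s ≤ t) :
    w s + x s - sin (x s) ≤ w t + x t - sin (x t) := by
  refine le_of_hasDerivAt_nonneg hst
    (fun r ↦ ((h.hasDerivAt_w r).add (h.hasDerivAt_x r)).sub (h.hasDerivAt_x r).sin)
    (fun r _ ↦ ?_)
  have hV := le_max_right (cos (w r) + cos (y r)) 1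
  nlinarith [cos_le_one (x r), neg_one_le_sin (y r)]

theorem w_sub_x_sub_sin_anti (h : IsTruncatedTrajectory x y w) {s t : ℝ} (hst : s ≤ t) :
    w t - x t - sin (x t) ≤ w s - x s - sin (x s) := by
  have := le_of_hasDerivAt_nonneg hst
    (fun r ↦ ((h.hasDerivAt_x r).sub (h.hasDerivAt_w r)).add (h.hasDerivAt_x r).sin)
    (fun r _ ↦ by
      have hV := le_max_right (cos (w r) + cos (y r)) 1
      nlinarith [neg_one_le_cos (x r), sin_le_one (y r)])
  simp only [Pi.sub_apply, Pi.add_apply] at this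
  linarith

end IsTruncatedTrajectory

end TruncatedTrajectory

theorem sub_sin_le_mul_sub_sq {u : ℝ} (h0 : 0 ≤ u) (h1 : u ≤ π / 2) :
    u - sin u ≤ π / 2 * u - u ^ 2 / 2 := by
  have hs := mul_le_sin h0 h1
  have hpi : (1 : ℝ) / 2 ≤ 2 / π := by
    rw [div_le_div_iff₀ two_pos pi_pos]; linarith [pi_le_four]
  nlinarith [pi_gt_three, mul_le_mul_of_nonneg_right hpi h0]

theorem neg_le_sin_of_neg_le {a b : ℝ} (hb : 0 ≤ b) (h : -b ≤ a) (ha : a ≤ π) : -b ≤ sin a := by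
  rcases le_total 0 a with h0 | h0
  · linarith [sin_nonneg_of_nonneg_of_le_pi h0 ha]
  · linarith [le_sin h0]

theorem sq_add_sq_le_two {a b x : ℝ} (h0 : 0 ≤ x) (h1 : x ≤ π / 2)
    (ha : |a| ≤ π ^ 2 / 8 - x ^ 2 / 2) (hb : |b| ≤ π / 2 * x - x ^ 2 / 2) :
    a ^ 2 + b ^ 2 ≤ 2 := by
  have ha2 : a ^ 2 ≤ (π ^ 2 / 8 - x ^ 2 / 2) ^ 2 := sq_le_sq' (abs_le.1 ha).1 (abs_le.1 ha).2
  have hb2 : b ^ 2 ≤ (π / 2 * x - x ^ 2 / 2) ^ 2 := sq_le_sq' (abs_le.1 hb).1 (abs_le.1 hb).2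
  have hm0 : 0 ≤ x * (π / 2 - x) := mul_nonneg h0 (by linarith)
  have hm1 : x * (π / 2 - x) ≤ π ^ 2 / 16 := by nlinarith [sq_nonneg (x - π / 4)]
  have hm2 : (x * (π / 2 - x)) ^ 2 ≤ (π ^ 2 / 16) ^ 2 := pow_le_pow_left₀ hm0 hm1 2
  have hpi2 : π ^ 2 ≤ 10 := by nlinarith [pi_lt_d2, pi_pos]
  have hpi4 : (π ^ 2) ^ 2 ≤ 10 ^ 2 := pow_le_pow_left₀ (sq_nonneg _) hpi2 2
  have hid : (π ^ 2 / 8 - x ^ 2 / 2) ^ 2 + (π / 2 * x - x ^ 2 / 2) ^ 2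
      = (π ^ 2 / 8) ^ 2 + (x * (π / 2 - x)) ^ 2 / 2 := by ring
  nlinarith

namespace IsTruncatedTrajectory

variable {x y w : ℝ → ℝ} {T : ℝ}

/-- A trajectory from the line `x = w = 0` to the line `x = π / 2`, `y = 0` never uses the
truncation. -/
theorem one_le_speed (h : IsTruncatedTrajectory x y w) (hx0 : x 0 = 0) (hw0 : w 0 = 0)
    (hxT : x T = π / 2) (hyT : y T = 0) {t : ℝ} (ht : t ∈ Icc 0 T) :
    1 ≤ cos (w t) + cos (y t) := by
  have hx : ∀ s ∈ Icc 0 T, 0 ≤ x s ∧ x s ≤ π / 2 := fun s hs ↦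
    ⟨by linarith [h.time_le_x_sub hs.1, hs.1], by linarith [h.time_le_x_sub hs.2, hs.2]⟩
  have hy_le : ∀ s ∈ Icc 0 T, y s ≤ π / 2 - x s - cos (x s) := fun s hs ↦ by
    have := h.y_add_x_add_cos_mono hs.2
    rw [hyT, hxT, cos_pi_div_two] at this
    linarith
  have hy_ge : ∀ s ∈ Icc 0 T, -π ≤ y s := fun s hs ↦ by
    have := h.y_sub_x_add_cos_anti hs.2
    rw [hyT, hxT, cos_pi_div_two] at this
    linarith [cos_le_one (x s), pi_gt_three, (hx s hs).1]
  have hw_ge : ∀ s ∈ Icc 0 T, -(x s - sin (x s)) ≤ w s := fun s hs ↦ by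
    have := h.w_add_x_sub_sin_mono hs.1
    rw [hw0, hx0, sin_zero] at this
    linarith
  have hw_le : ∀ s ∈ Icc 0 T, w s ≤ π := fun s hs ↦ by
    have := h.w_sub_x_sub_sin_anti hs.1
    rw [hw0, hx0, sin_zero] at this
    linarith [sin_le_one (x s), pi_gt_three, (hx s hs).2]
  have hsin_w : ∀ s ∈ Icc 0 T, -(x s - sin (x s)) ≤ sin (w s) := fun s hs ↦
    neg_le_sin_of_neg_le (sub_nonneg.2 (sin_le (hx s hs).1)) (hw_ge s hs) (hw_le s hs)
  have hcos_x : ∀ s ∈ Icc 0 T, cos (x s) ≤ π / 2 - x s := fun s hs ↦ by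
    have := sin_le (x := π / 2 - x s) (by linarith [(hx s hs).2])
    rwa [sin_pi_div_two_sub] at this
  have hsin_y : ∀ s ∈ Icc 0 T, sin (y s) ≤ π / 2 - x s - cos (x s) := fun s hs ↦ by
    have := neg_le_sin_of_neg_le (a := -y s) (sub_nonneg.2 (hcos_x s hs))
      (by linarith [hy_le s hs]) (by linarith [hy_ge s hs])
    rw [sin_neg] at this
    linarith
  have hy_lower : -(π ^ 2 / 8 - x t ^ 2 / 2) ≤ y t := by
    have := le_of_hasDerivAt_nonneg ht.2
      (fun r ↦ (((h.hasDerivAt_x r).pow 2).div_const 2).sub (h.hasDerivAt_y r))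
      (fun r hr ↦ by
        have hr' : r ∈ Icc 0 T := ⟨ht.1.trans hr.1, hr.2⟩
        have hV := le_max_right (cos (w r) + cos (y r)) 1
        simp only [Nat.cast_ofNat, Nat.add_one_sub_one, pow_one]
        nlinarith [hsin_w r hr', (hx r hr').1])
    simp only [Pi.sub_apply, Pi.pow_apply] at this
    rw [hxT, hyT] at this
    linarith
  have hw_upper : w t ≤ π / 2 * x t - x t ^ 2 / 2 := by
    have := le_of_hasDerivAt_nonneg ht.1
      (fun r ↦ (((h.hasDerivAt_x r).const_mul (π / 2)).sub
        (((h.hasDerivAt_x r).pow 2).div_const 2)).sub (h.hasDerivAt_w r))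
      (fun r hr ↦ by
        have hr' : r ∈ Icc 0 T := ⟨hr.1, hr.2.trans ht.2⟩
        have hV := le_max_right (cos (w r) + cos (y r)) 1
        simp only [Nat.cast_ofNat, Nat.add_one_sub_one, pow_one]
        nlinarith [hsin_y r hr', (hx r hr').2])
    simp only [Pi.sub_apply, Pi.pow_apply] at this
    rw [hx0, hw0] at this
    linarith
  obtain ⟨hxt0, hxt1⟩ := hx t ht
  have hy_upper : y t ≤ π ^ 2 / 8 - x t ^ 2 / 2 := by
    have h1 := sub_sin_le_mul_sub_sq (u := π / 2 - x t) (by linarith) (by linarith)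
    rw [sin_pi_div_two_sub] at h1
    linarith [hy_le t ht]
  have hw_lower : -(π / 2 * x t - x t ^ 2 / 2) ≤ w t := by
    linarith [sub_sin_le_mul_sub_sq hxt0 hxt1, hw_ge t ht]
  have hsq := sq_add_sq_le_two hxt0 hxt1 (abs_le.2 ⟨hy_lower, hy_upper⟩)
    (abs_le.2 ⟨hw_lower, hw_upper⟩)
  linarith [one_sub_sq_div_two_le_cos (x := y t), one_sub_sq_div_two_le_cos (x := w t)]

end IsTruncatedTrajectory

theorem isTruncatedTrajectory_of_hasDerivAt {X : ℝ → ℝ × ℝ × ℝ}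
    (h : ∀ t, HasDerivAt X (truncatedField 1 (X t)) t) :
    IsTruncatedTrajectory (fun t ↦ (X t).1) (fun t ↦ (X t).2.1) (fun t ↦ (X t).2.2) :=
  ⟨fun t ↦ (h t).prod_coords.1, fun t ↦ (h t).prod_coords.2.1, fun t ↦ (h t).prod_coords.2.2⟩

/-- Some truncated trajectory joins the line `x = w = 0` to the line `x = π / 2`, `y = 0`. -/
theorem exists_truncatedField_connection :
    ∃ (X : ℝ → ℝ × ℝ × ℝ) (T : ℝ), 0 < T ∧ (∀ t, HasDerivAt X (truncatedField 1 (X t)) t) ∧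
      (X 0).1 = 0 ∧ (X 0).2.2 = 0 ∧ (X T).1 = π / 2 ∧ (X T).2.1 = 0 := by
  have hexists (η : ℝ) := exists_truncatedField_solution (c := 1) (by norm_num) (0, η, 0)
  choose X hX0 hX using hexists
  have htraj (η : ℝ) := isTruncatedTrajectory_of_hasDerivAt (hX η)
  have hhit (η : ℝ) : ∃ T ∈ Icc 0 (π / 2), (X η T).1 = π / 2 := by
    have hcont : Continuous fun t ↦ (X η t).1 :=
      continuous_iff_continuousAt.2 fun t ↦ ((htraj η).hasDerivAt_x t).continuousAt
    have hend := (htraj η).time_le_x_sub pi_div_two_pos.le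
    refine intermediate_value_Icc pi_div_two_pos.le hcont.continuousOn ⟨?_, ?_⟩
    · simp [hX0, pi_div_two_pos.le]
    · simpa [hX0] using hend
  choose T hT hXT using hhit
  have hdist (η ξ t : ℝ) (ht : t ∈ Icc 0 (π / 2)) :
      dist (X η t) (X ξ t) ≤ dist η ξ * exp (2 * (π / 2)) := by
    have hcont (ζ : ℝ) : Continuous (X ζ) :=
      continuous_iff_continuousAt.2 fun s ↦ (hX ζ s).continuousAt
    have := dist_le_of_trajectories_ODE (v := fun _ ↦ truncatedField 1) (δ := dist η ξ)
      (fun _ ↦ lipschitzWith_truncatedField 1) (hcont η).continuousOn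
      (fun s _ ↦ (hX η s).hasDerivWithinAt) (hcont ξ).continuousOn
      (fun s _ ↦ (hX ξ s).hasDerivWithinAt) (by simp [hX0, Prod.dist_eq]) t ht
    refine this.trans (mul_le_mul_of_nonneg_left (exp_le_exp.2 ?_) dist_nonneg)
    simpa using ht.2
  have hT_dist (η ξ : ℝ) : dist (T η) (T ξ) ≤ dist η ξ * exp (2 * (π / 2)) := by
    have hle : dist (T η) (T ξ) ≤ |(X ξ (T η)).1 - (X ξ (T ξ)).1| := by
      rw [Real.dist_eq]
      rcases le_total (T η) (T ξ) with hle | hle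
      · have := (htraj ξ).time_le_x_sub hle
        rw [abs_of_nonpos (by linarith), abs_of_nonpos (by linarith)]
        linarith
      · have := (htraj ξ).time_le_x_sub hle
        rw [abs_of_nonneg (by linarith), abs_of_nonneg (by linarith)]
        linarith
    rw [hXT ξ, ← hXT η, ← Real.dist_eq, dist_comm (X ξ (T η)).1] at hle
    exact (hle.trans (le_max_left _ _)).trans (hdist η ξ (T η) (hT η))
  have hT_cont : Continuous T :=
    (LipschitzWith.of_dist_le_mul (K := ⟨exp (2 * (π / 2)), (exp_pos _).le⟩) fun η ξ ↦ by
      rw [mul_comm]; exact hT_dist η ξ).continuous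
  have hflow : ContinuousOn (fun q : ℝ × ℝ ↦ X q.1 q.2) (univ ×ˢ Icc 0 (π / 2)) := by
    refine continuousOn_prod_of_continuousOn_lipschitzOnWith _
      ⟨exp (2 * (π / 2)), (exp_pos _).le⟩
      (fun η _ t _ ↦ (hX η t).continuousAt.continuousWithinAt) (fun t ht ↦ ?_)
    refine LipschitzOnWith.of_dist_le_mul fun η _ ξ _ ↦ ?_
    rw [mul_comm]
    exact hdist η ξ t ht
  have hend_cont : Continuous fun η ↦ (X η (T η)).2.1 := by
    have : Continuous fun η ↦ X η (T η) :=
      hflow.comp_continuous (continuous_id.prodMk hT_cont) fun η ↦ ⟨trivial, hT η⟩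
    exact this.snd.fst
  have hlow : (X (-π) (T (-π))).2.1 ≤ 0 := by
    have := (htraj (-π)).y_sub_x_add_cos_anti (hT (-π)).1
    simp only [hXT, hX0, cos_pi_div_two, cos_zero] at this
    linarith [pi_gt_three]
  have hhigh : 0 ≤ (X π (T π)).2.1 := by
    have := (htraj π).y_add_x_add_cos_mono (hT π).1
    simp only [hXT, hX0, cos_pi_div_two, cos_zero] at this
    linarith [pi_gt_three]
  obtain ⟨η, -, hη⟩ := intermediate_value_Icc (by linarith [pi_pos] : -π ≤ π)
    hend_cont.continuousOn ⟨hlow, hhigh⟩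
  refine ⟨X η, T η, lt_of_le_of_ne (hT η).1 fun h0 ↦ ?_, hX η, by simp [hX0], by simp [hX0],
    hXT η, hη⟩
  have := hXT η
  rw [← h0, hX0] at this
  exact pi_div_two_pos.ne this

theorem truncatedField_neg_two (q : ℝ × ℝ × ℝ) :
    truncatedField (-2) q =
      (cos q.2.2 + cos q.2.1, sin q.1 - sin q.2.2, sin q.2.1 + cos q.1) := by
  simp only [truncatedField, Prod.mk.injEq, and_true]
  exact max_eq_left (by linarith [neg_one_le_cos q.2.2, neg_one_le_cos q.2.1])

/-- Two integral curves of the ABC field that agree at one time are equal. -/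
theorem abcField_solution_unique {X Y : ℝ → ℝ × ℝ × ℝ} {t₀ : ℝ}
    (hX : ∀ t, HasDerivAt X (truncatedField (-2) (X t)) t)
    (hY : ∀ t, HasDerivAt Y (truncatedField (-2) (Y t)) t) (h : X t₀ = Y t₀) : X = Y :=
  ODE_solution_unique_univ (v := fun _ ↦ truncatedField (-2)) (s := fun _ ↦ univ) (t₀ := t₀)
    (fun _ ↦ (lipschitzWith_truncatedField _).lipschitzOnWith) (fun t ↦ ⟨hX t, trivial⟩)
    (fun t ↦ ⟨hY t, trivial⟩) h

/-- An integral curve of the ABC field joining the line `x = w = 0` to the line `x = π / 2`,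
`y = 0`. -/
theorem exists_abcField_connection :
    ∃ (X : ℝ → ℝ × ℝ × ℝ) (T : ℝ), 0 < T ∧ (∀ t, HasDerivAt X (truncatedField (-2) (X t)) t) ∧
      (X 0).1 = 0 ∧ (X 0).2.2 = 0 ∧ (X T).1 = π / 2 ∧ (X T).2.1 = 0 := by
  obtain ⟨Y, T, hT, hY, hx0, hw0, hxT, hyT⟩ := exists_truncatedField_connection
  obtain ⟨X, hX0, hX⟩ := exists_truncatedField_solution (c := -2) (by norm_num) (Y 0)
  have hcont {Z : ℝ → ℝ × ℝ × ℝ} {c : ℝ} (hZ : ∀ t, HasDerivAt Z (truncatedField c (Z t)) t) :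
      Continuous Z := continuous_iff_continuousAt.2 fun s ↦ (hZ s).continuousAt
  have heq : EqOn X Y (Icc 0 T) := by
    refine ODE_solution_unique (v := fun _ ↦ truncatedField (-2))
      (fun _ ↦ lipschitzWith_truncatedField _) (hcont hX).continuousOn
      (fun t _ ↦ (hX t).hasDerivWithinAt) (hcont hY).continuousOn (fun t ht ↦ ?_) hX0
    have hspeed := (isTruncatedTrajectory_of_hasDerivAt hY).one_le_speed hx0 hw0 hxT hyT
      (Ico_subset_Icc_self ht)
    have : truncatedField (-2) (Y t) = truncatedField 1 (Y t) := by
      rw [truncatedField_neg_two, truncatedField, max_eq_left hspeed]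
    rw [this]
    exact (hY t).hasDerivWithinAt
  have hXT := heq (right_mem_Icc.2 hT.le)
  exact ⟨X, T, hT, hX, hX0 ▸ hx0, hX0 ▸ hw0, hXT ▸ hxT, hXT ▸ hyT⟩

/-- The ABC flow has an orbit that is periodic up to a translation by `2π` in the `x` direction. -/
theorem exists_isABCSol_translation :
    ∃ (x y z : ℝ → ℝ) (τ : ℝ), 0 < τ ∧ IsABCSol x y z ∧ (∀ t, x (t + τ) = x t + 2 * π) ∧
      (∀ t, y (t + τ) = y t) ∧ ∀ t, z (t + τ) = z t := by
  obtain ⟨X, T, hT, hX, hx0, hw0, hxT, hyT⟩ := exists_abcField_connection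
  have hX' (t : ℝ) := (hX t).prod_coords
  simp only [truncatedField_neg_two] at hX'
  have hrev (c t : ℝ) : HasDerivAt (fun s ↦ c - s) (-1) t := by
    simpa using (hasDerivAt_id t).const_sub c
  have hR0 : (fun t ↦ (-(X (0 - t)).1, (X (0 - t)).2.1, -(X (0 - t)).2.2)) = X := by
    refine abcField_solution_unique (t₀ := 0) (fun t ↦ ?_) hX ?_
    · obtain ⟨h1, h2, h3⟩ := hX' (0 - t)
      rw [truncatedField_neg_two]
      refine ((h1.comp t (hrev 0 t)).neg.prodMk
        ((h2.comp t (hrev 0 t)).prodMk (h3.comp t (hrev 0 t)).neg)).congr_deriv ?_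
      ext <;> (simp; try ring)
    · ext <;> simp [hx0, hw0]
  have hR1 : (fun t ↦ (π - (X (2 * T - t)).1, -(X (2 * T - t)).2.1, (X (2 * T - t)).2.2)) = X := by
    have hmid : 2 * T - T = T := by ring
    refine abcField_solution_unique (t₀ := T) (fun t ↦ ?_) hX ?_
    · obtain ⟨h1, h2, h3⟩ := hX' (2 * T - t)
      rw [truncatedField_neg_two]
      refine (((h1.comp t (hrev (2 * T) t)).const_sub π).prodMk
        ((h2.comp t (hrev (2 * T) t)).neg.prodMk (h3.comp t (hrev (2 * T) t)))).congr_deriv ?_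
      ext <;> (simp; try ring)
    · ext
      · simp [hmid, hxT]; ring
      · simp [hmid, hyT]
      · simp [hmid]
  have hhalf (t : ℝ) : X (t + 2 * T) = (π + (X t).1, -(X t).2.1, -(X t).2.2) := by
    have e1 := congrFun hR1 (t + 2 * T)
    have e0 := congrFun hR0 t
    have harg : 2 * T - (t + 2 * T) = 0 - t := by ring
    simp only [harg] at e1
    rw [← e1, ← e0]
    simp [sub_eq_add_neg]
  have hfull (t : ℝ) : X (t + 4 * T) = (2 * π + (X t).1, (X t).2.1, (X t).2.2) := by
    have harg : t + 4 * T = t + 2 * T + 2 * T := by ring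
    rw [harg, hhalf, hhalf]
    ext
    · simp; ring
    · simp
    · simp
  refine ⟨fun t ↦ (X t).1, fun t ↦ (X t).2.1, fun t ↦ (X t).2.2 + π / 2, 4 * T, by linarith,
    fun t ↦ ?_, fun t ↦ ?_, fun t ↦ ?_, fun t ↦ ?_⟩
  · obtain ⟨h1, h2, h3⟩ := hX' t
    simp only [sin_add_pi_div_two, cos_add_pi_div_two]
    exact ⟨h1, h2, h3.add_const _⟩
  · simp [hfull, add_comm]
  · simp [hfull]
  · simp [hfull]

namespace IsABCSol

variable {x y z : ℝ → ℝ}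

theorem rotate (h : IsABCSol x y z) : IsABCSol y z x := fun t ↦
  ⟨(h t).2.1, (h t).2.2, (h t).1⟩

theorem reverse (h : IsABCSol x y z) :
    IsABCSol (fun t ↦ x (-t) + π) (fun t ↦ y (-t) + π) (fun t ↦ z (-t) + π) := fun t ↦ by
  obtain ⟨h1, h2, h3⟩ := h (-t)
  simp only [sin_add_pi, cos_add_pi]
  refine ⟨?_, ?_, ?_⟩
  · exact ((h1.comp t (hasDerivAt_neg t)).add_const π).congr_deriv (by ring)
  · exact ((h2.comp t (hasDerivAt_neg t)).add_const π).congr_deriv (by ring)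
  · exact ((h3.comp t (hasDerivAt_neg t)).add_const π).congr_deriv (by ring)

end IsABCSol

/-- A continuous function that increases by `D` over each period `τ` has average slope `D / τ`. -/
theorem tendsto_div_of_add_period {f : ℝ → ℝ} {τ D : ℝ} (hτ : 0 < τ) (hf : Continuous f)
    (h : ∀ t, f (t + τ) = f t + D) : Tendsto (fun t ↦ f t / t) atTop (𝓝 (D / τ)) := by
  have hper : Function.Periodic (fun t ↦ f t - D / τ * t) τ := fun t ↦ by
    simp only [h]
    field_simp
    ring
  obtain ⟨C, hC⟩ := (hper.isBounded_of_continuous hτ.ne' (by fun_prop)).exists_norm_le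
  have hC' (t : ℝ) : |f t - D / τ * t| ≤ C := hC _ (mem_range_self t)
  have hlim : Tendsto (fun t ↦ (f t - D / τ * t) / t) atTop (𝓝 0) :=
    tendsto_bdd_div_atTop_nhds_zero (.of_forall fun t ↦ (abs_le.1 (hC' t)).1)
      (.of_forall fun t ↦ (abs_le.1 (hC' t)).2) tendsto_id
  have hadd := hlim.add_const (D / τ)
  rw [zero_add] at hadd
  refine hadd.congr' ?_
  filter_upwards [eventually_gt_atTop 0] with t ht
  field_simp
  ring

/-- Linear growth of `a x + b y + c z` along a solution that is periodic up to a translation. -/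
theorem limsup_pos_of_add_period {x y z : ℝ → ℝ} {τ a b c dx dy dz : ℝ} (h : IsABCSol x y z)
    (hτ : 0 < τ) (hx : ∀ t, x (t + τ) = x t + dx) (hy : ∀ t, y (t + τ) = y t + dy)
    (hz : ∀ t, z (t + τ) = z t + dz) (hpos : 0 < a * dx + b * dy + c * dz) :
    0 < limsup (fun t ↦ (a * x t + b * y t + c * z t) / t) atTop := by
  have hcx : Continuous x := continuous_iff_continuousAt.2 fun t ↦ (h t).1.continuousAt
  have hcy : Continuous y := continuous_iff_continuousAt.2 fun t ↦ (h t).2.1.continuousAt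
  have hcz : Continuous z := continuous_iff_continuousAt.2 fun t ↦ (h t).2.2.continuousAt
  have := tendsto_div_of_add_period (f := fun t ↦ a * x t + b * y t + c * z t)
    (D := a * dx + b * dy + c * dz) hτ (by fun_prop) fun t ↦ by
      simp only [hx, hy, hz]
      ring
  rw [this.limsup_eq]
  positivity

/-- Orbits of the ABC flow that are periodic up to a translation by `±2π` in the `x` direction. -/
theorem exists_isABCSol_shift (σ : ℝ) (hσ : σ = 1 ∨ σ = -1) :
    ∃ (x y z : ℝ → ℝ) (τ : ℝ), 0 < τ ∧ IsABCSol x y z ∧ (∀ t, x (t + τ) = x t + σ * (2 * π)) ∧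
      (∀ t, y (t + τ) = y t + 0) ∧ ∀ t, z (t + τ) = z t + 0 := by
  obtain ⟨x, y, z, τ, hτ, h, hx, hy, hz⟩ := exists_isABCSol_translation
  rcases hσ with rfl | rfl
  · exact ⟨x, y, z, τ, hτ, h, by simpa using hx, by simpa using hy, by simpa using hz⟩
  · have harg (t : ℝ) : -t = -(t + τ) + τ := by ring
    refine ⟨_, _, _, τ, hτ, h.reverse, fun t ↦ ?_, fun t ↦ ?_, fun t ↦ ?_⟩
    · rw [harg t, hx]; ring
    · rw [harg t, hy]; ring
    · rw [harg t, hz]; ring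

theorem exists_sign_mul_pos {a : ℝ} (ha : a ≠ 0) : ∃ σ : ℝ, (σ = 1 ∨ σ = -1) ∧ 0 < a * σ := by
  rcases ha.lt_or_gt with h | h
  · exact ⟨-1, .inr rfl, by linarith⟩
  · exact ⟨1, .inl rfl, by linarith⟩

theorem stmt19 (p : ℝ × ℝ × ℝ) (hp : p ≠ 0) :
    ∃ x y z : ℝ → ℝ, IsABCSol x y z ∧
      0 < Filter.limsup
        (fun t => (p.1 * x t + p.2.1 * y t + p.2.2 * z t) / t) Filter.atTop := by
  obtain ⟨a, b, c⟩ := p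
  have hpos {r : ℝ} (hr : r ≠ 0) : ∃ σ : ℝ, (σ = 1 ∨ σ = -1) ∧ 0 < r * (σ * (2 * π)) := by
    obtain ⟨σ, hσ, hrσ⟩ := exists_sign_mul_pos hr
    exact ⟨σ, hσ, by rw [← mul_assoc]; exact mul_pos hrσ two_pi_pos⟩
  by_cases ha : a = 0
  · by_cases hb : b = 0
    · have hc : c ≠ 0 := fun hc ↦ hp (by simp [ha, hb, hc])
      obtain ⟨σ, hσ, hcσ⟩ := hpos hc
      obtain ⟨x, y, z, τ, hτ, h, hx, hy, hz⟩ := exists_isABCSol_shift σ hσ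
      exact ⟨y, z, x, h.rotate, limsup_pos_of_add_period h.rotate hτ hy hz hx (by simpa using hcσ)⟩
    · obtain ⟨σ, hσ, hbσ⟩ := hpos hb
      obtain ⟨x, y, z, τ, hτ, h, hx, hy, hz⟩ := exists_isABCSol_shift σ hσ
      exact ⟨z, x, y, h.rotate.rotate,
        limsup_pos_of_add_period h.rotate.rotate hτ hz hx hy (by simpa using hbσ)⟩
  · obtain ⟨σ, hσ, haσ⟩ := hpos ha
    obtain ⟨x, y, z, τ, hτ, h, hx, hy, hz⟩ := exists_isABCSol_shift σ hσ
    exact ⟨x, y, z, h, limsup_pos_of_add_period h hτ hx hy hz (by simpa using haσ)⟩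
end
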